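/- arXiv:1601.08067 — 16 statements merged into one kernel-verified Lean document; each statement's English description precedes it below -/
import Mathlib

section
/- Let d ≥ 3 and let γ, ε be reals with 0 < ε ≤ γ. Define points s_1,…,s_{d+1} ∈ ℝ^d as follows: for 1 ≤ i ≤ d, the l-th coordinate of s_i equals 0 if l < i, equals γ if l = i, and equals ε if l > i; every coordinate of s_{d+1} equals −γ. Then there is no point u ∈ ℝ^d such that for every subset D ⊆ {1,…,d} with |D| = 2 and every index i ∈ {1,…,d+1}, g_D(u) lies in the convex hull of {g_D(s_j) : 1 ≤ j ≤ d+1, j ≠ i}. Equivalently, the intersection over all i ∈ {1,…,d+1} of the 2-relaxed convex hulls H_2({s_j : j ≠ i}) is empty. -/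
/-- The `D`-projection of a vector in `ℝ^d`, retaining only coordinates with index in `D`. -/
def proj {d : ℕ} (D : Finset (Fin d)) (u : Fin d → ℝ) : D → ℝ := fun i => u i

/-- The `k`-relaxed convex hull of `S ⊆ ℝ^d`. -/
def relaxedHull {d : ℕ} (k : ℕ) (S : Set (Fin d → ℝ)) : Set (Fin d → ℝ) :=
  {u | ∀ D : Finset (Fin d), D.card = k → proj D u ∈ convexHull ℝ (proj D '' S)}

/-- A linear inequality in two coordinates that holds on `S` holds on its 2-relaxed convex hull. -/
theorem relaxedHull_two_linear_le {d : ℕ} {S : Set (Fin d → ℝ)} {u : Fin d → ℝ}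
    (hu : u ∈ relaxedHull 2 S) {a b : Fin d} (hab : a ≠ b) (α β c : ℝ)
    (h : ∀ v ∈ S, α * v a + β * v b ≤ c) : α * u a + β * u b ≤ c := by
  have ha : a ∈ ({a, b} : Finset (Fin d)) := by simp
  have hb : b ∈ ({a, b} : Finset (Fin d)) := by simp
  let f : (({a, b} : Finset (Fin d)) → ℝ) →ₗ[ℝ] ℝ :=
    α • LinearMap.proj ⟨a, ha⟩ + β • LinearMap.proj ⟨b, hb⟩
  have hsub : convexHull ℝ (proj {a, b} '' S) ⊆ {w | f w ≤ c} := by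
    refine convexHull_min ?_ (convex_halfSpace_le f.isLinear c)
    rintro _ ⟨v, hv, rfl⟩
    exact h v hv
  exact hsub (hu {a, b} (Finset.card_pair hab))

/-- For `d ≥ 3` and `0 < ε ≤ γ`, with the points `s_1, …, s_{d+1}` defined as in the paper
(the `l`-th coordinate of `s_i` is `0` for `l < i`, `γ` for `l = i`, `ε` for `l > i`, for
`i ≤ d`, and all coordinates of `s_{d+1}` are `-γ`), the intersection over all
`i ∈ {1, …, d+1}` of the 2-relaxed convex hulls of `{s_j : j ≠ i}` is empty. -/
theorem relaxed_two_hull_intersection_empty (d : ℕ) (hd : 3 ≤ d) (γ ε : ℝ)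
    (hε : 0 < ε) (hεγ : ε ≤ γ)
    (s : Fin (d + 1) → Fin d → ℝ)
    (hs : s = fun (i : Fin (d + 1)) (l : Fin d) =>
      if (i : ℕ) = d then -γ
      else if (l : ℕ) < (i : ℕ) then 0
      else if (l : ℕ) = (i : ℕ) then γ
      else ε) :
    (⋂ i : Fin (d + 1), relaxedHull 2 (s '' {j | j ≠ i})) = ∅ := by
  refine Set.eq_empty_iff_forall_notMem.mpr fun u hu => ?_
  rw [Set.mem_iInter] at hu
  have hle : ∀ m (hm : m < d), u ⟨m, hm⟩ ≤ 0 := by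
    intro m
    induction m with
    | zero =>
      intro hm
      have key := relaxedHull_two_linear_le (hu ⟨0, by omega⟩)
        (a := ⟨0, hm⟩) (b := ⟨1, by omega⟩) (by simp) 1 0 0 (by
          rintro _ ⟨j, hj, rfl⟩
          have hj0 : (j : ℕ) ≠ 0 := fun h => hj (Fin.ext h)
          simp only [hs]
          split_ifs <;> first | omega | linarith)
      linarith
    | succ m ih =>
      intro hm
      have key := relaxedHull_two_linear_le (hu ⟨m + 1, by omega⟩)
        (a := ⟨m, by omega⟩) (b := ⟨m + 1, hm⟩) (by simp) (-1) 1 0 (by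
          rintro _ ⟨j, hj, rfl⟩
          have hjm : (j : ℕ) ≠ m + 1 := fun h => hj (Fin.ext h)
          simp only [hs]
          split_ifs <;> first | omega | linarith)
      linarith [ih (by omega)]
  have key := relaxedHull_two_linear_le (hu (Fin.last d))
    (a := ⟨d - 1, by omega⟩) (b := ⟨0, by omega⟩) (by simp; omega) (-1) 0 (-ε) (by
      rintro _ ⟨j, hj, rfl⟩
      have hjd : (j : ℕ) ≠ d := fun h => hj (Fin.ext h)
      have hj_lt := j.isLt
      simp only [hs]
      split_ifs <;> first | omega | linarith)
  linarith [hle (d - 1) (by omega)]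
end

section
/- Let d ≥ 2, let δ > 0, and let x > 2dδ. Let e_1,…,e_d denote the standard basis of ℝ^d, and set p_i = x·e_i for 1 ≤ i ≤ d and p_{d+1} = 0. Then the intersection over all i ∈ {1,…,d+1} of H_{(δ,∞)}({p_j : 1 ≤ j ≤ d+1, j ≠ i}) is empty; that is, there is no u ∈ ℝ^d such that for every i ∈ {1,…,d+1} there exists v in the convex hull of {p_j : j ≠ i} with ‖u − v‖_∞ ≤ δ. -/
/-- The `(δ,∞)`-relaxed convex hull of `S ⊆ ℝ^d`: points within sup-norm distance `δ`
of the convex hull of `S`.  Here `Fin d → ℝ` carries the sup norm `‖·‖_∞`. -/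
def deltaHullInf {d : ℕ} (δ : ℝ) (S : Set (Fin d → ℝ)) : Set (Fin d → ℝ) :=
  {u | ∃ v ∈ convexHull ℝ S, ‖u - v‖ ≤ δ}

/-- A linear functional that is constant on a set is constant on its convex hull. -/
theorem LinearMap.eq_of_mem_convexHull {E : Type*} [AddCommGroup E] [Module ℝ E]
    (f : E →ₗ[ℝ] ℝ) {S : Set E} {c : ℝ} (hS : ∀ y ∈ S, f y = c) {v : E}
    (hv : v ∈ convexHull ℝ S) : f v = c :=
  convexHull_min (t := f ⁻¹' {c}) hS ((convex_singleton c).linear_preimage f) hv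

/-- For `d ≥ 2`, `δ > 0` and `x > 2dδ`, with `p_i = x·e_i` for `i ≤ d` and `p_{d+1} = 0`,
the intersection over all `i ∈ {1, …, d+1}` of the `(δ,∞)`-relaxed convex hulls of
`{p_j : j ≠ i}` is empty. -/
theorem deltaHullInf_intersection_empty (d : ℕ) (hd : 2 ≤ d) (δ x : ℝ)
    (hδ : 0 < δ) (hx : 2 * d * δ < x)
    (p : Fin (d + 1) → Fin d → ℝ)
    (hp : p = fun (i : Fin (d + 1)) (l : Fin d) => if (l : ℕ) = (i : ℕ) then x else 0) :
    (⋂ i : Fin (d + 1), deltaHullInf δ (p '' {j | j ≠ i})) = ∅ := by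
  refine Set.eq_empty_iff_forall_notMem.2 fun u hu => ?_
  rw [Set.mem_iInter] at hu
  have upper (l : Fin d) : u l ≤ δ := by
    obtain ⟨v, hv, huv⟩ := hu l.castSucc
    have hvl : v l = 0 := by
      refine LinearMap.eq_of_mem_convexHull (LinearMap.proj l) ?_ hv
      rintro _ ⟨j, hj, rfl⟩
      have hlj : (l : ℕ) ≠ j := fun h => hj (Fin.ext h.symm)
      simp [hp, hlj]
    have h := (norm_le_pi_norm (u - v) l).trans huv
    rw [Pi.sub_apply, hvl, sub_zero] at h
    exact (le_abs_self _).trans h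
  obtain ⟨v, hv, huv⟩ := hu (Fin.last d)
  have sum_v : ∑ l, v l = x := by
    have h : (∑ l : Fin d, LinearMap.proj (R := ℝ) (φ := fun _ => ℝ) l) v = x := by
      refine LinearMap.eq_of_mem_convexHull _ ?_ hv
      rintro _ ⟨j, hj, rfl⟩
      obtain ⟨k, rfl⟩ := Fin.exists_castSucc_eq.2 hj
      simp [hp, Fin.val_inj]
    simpa using h
  have v_le (l : Fin d) : v l ≤ 2 * δ := by
    have h := (abs_le.1 ((norm_le_pi_norm (u - v) l).trans huv)).1
    rw [Pi.sub_apply] at h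
    linarith [upper l]
  have h := Finset.sum_le_sum fun l (_ : l ∈ Finset.univ) => v_le l
  rw [sum_v, Finset.sum_const, Finset.card_univ, Fintype.card_fin, nsmul_eq_mul] at h
  linarith
end

section
/- Let d ≥ 3 and let γ, ε be reals with 0 < 2ε < γ. Define points s_1,…,s_{d+1} ∈ ℝ^d as follows: for 1 ≤ i ≤ d, the l-th coordinate of s_i equals 0 if l < i, equals γ if l = i, and equals 2ε if l > i; every coordinate of s_{d+1} equals −γ. For each j ∈ {1,…,d+1}, let S^j = {s_t : 1 ≤ t ≤ d+1, t ≠ j}, and for i ∈ {1,2} define Ψ_i as the intersection over all j ∈ {1,…,d+1} with j ≠ i of the 2-relaxed convex hulls H_2(S^j). Then for every v_1 ∈ Ψ_1 and v_2 ∈ Ψ_2, ‖v_1 − v_2‖_∞ ≥ 2ε. -/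
/-- A linear inequality in two distinct coordinates passes from `S` to its `2`-relaxed hull. -/
theorem le_of_mem_relaxedHull_two {d : ℕ} {S : Set (Fin d → ℝ)} {u : Fin d → ℝ}
    (hu : u ∈ relaxedHull 2 S) {a b : Fin d} (hab : a ≠ b) (p q c : ℝ)
    (h : ∀ x ∈ S, c ≤ p * x a + q * x b) : c ≤ p * u a + q * u b := by
  let D : Finset (Fin d) := {a, b}
  have ha : a ∈ D := by simp [D]
  have hb : b ∈ D := by simp [D]
  let φ : (D → ℝ) →ₗ[ℝ] ℝ :=
    p • LinearMap.proj ⟨a, ha⟩ + q • LinearMap.proj ⟨b, hb⟩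
  have hφ (x : Fin d → ℝ) : φ (proj D x) = p * x a + q * x b := by simp [φ, proj]
  have hsub : proj D '' S ⊆ {w | c ≤ φ w} := by
    rintro _ ⟨x, hx, rfl⟩
    simpa only [Set.mem_ofPred_eq, hφ] using h x hx
  have hconv : Convex ℝ {w | c ≤ φ w} := convex_halfSpace_ge φ.isLinear c
  have hmem := convexHull_min hsub hconv (hu D (Finset.card_pair hab))
  simpa only [Set.mem_ofPred_eq, hφ] using hmem

/-- For `d ≥ 3` and `0 < 2ε < γ`, with `s_1, …, s_{d+1}` as in the paper
(`l`-th coordinate of `s_i` is `0` for `l < i`, `γ` for `l = i`, `2ε` for `l > i`, for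
`i ≤ d`, and all coordinates of `s_{d+1}` equal `-γ`), letting `S^j = {s_t : t ≠ j}`
and `Ψ_i = ⋂_{j ≠ i} H_2(S^j)`, any `v₁ ∈ Ψ_1` and `v₂ ∈ Ψ_2` satisfy
`‖v₁ - v₂‖_∞ ≥ 2ε` (here `Fin d → ℝ` carries the sup norm). -/
theorem relaxed_two_hull_separation (d : ℕ) (hd : 3 ≤ d) (γ ε : ℝ)
    (hε : 0 < ε) (hεγ : 2 * ε < γ)
    (s : Fin (d + 1) → Fin d → ℝ)
    (hs : s = fun (i : Fin (d + 1)) (l : Fin d) =>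
      if (i : ℕ) = d then -γ
      else if (l : ℕ) < (i : ℕ) then 0
      else if (l : ℕ) = (i : ℕ) then γ
      else 2 * ε)
    (v₁ v₂ : Fin d → ℝ)
    (hv₁ : v₁ ∈ ⋂ j ∈ {j : Fin (d + 1) | j ≠ 0}, relaxedHull 2 (s '' {t | t ≠ j}))
    (hv₂ : v₂ ∈ ⋂ j ∈ {j : Fin (d + 1) | j ≠ 1}, relaxedHull 2 (s '' {t | t ≠ j})) :
    2 * ε ≤ ‖v₁ - v₂‖ := by
  simp only [Set.mem_iInter, Set.mem_ofPred_eq] at hv₁ hv₂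
  have hanti (n : ℕ) (hn : n + 1 < d) : v₁ ⟨n + 1, hn⟩ ≤ v₁ ⟨n, by omega⟩ := by
    have key := le_of_mem_relaxedHull_two (hv₁ ⟨n + 1, by omega⟩ (by simp [Fin.ext_iff]))
      (a := ⟨n, by omega⟩) (b := ⟨n + 1, hn⟩) (by simp) 1 (-1) 0 (by
        rintro _ ⟨t, ht, rfl⟩
        simp only [Set.mem_ofPred_eq, ne_eq, Fin.ext_iff] at ht
        simp only [hs]
        split_ifs <;> first | omega | linarith)
    linarith
  have hle (n : ℕ) (hn : n < d) : v₁ ⟨n, hn⟩ ≤ v₁ ⟨0, by omega⟩ := by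
    induction n with
    | zero => exact le_rfl
    | succ n ih => exact (hanti n hn).trans (ih (by omega))
  have hlast : 2 * ε ≤ v₁ ⟨d - 1, by omega⟩ := by
    have key := le_of_mem_relaxedHull_two
      (hv₁ ⟨d, by omega⟩ (by simp only [ne_eq, Fin.ext_iff, Fin.val_zero]; omega))
      (a := ⟨d - 1, by omega⟩) (b := ⟨0, by omega⟩)
      (by simp only [ne_eq, Fin.ext_iff]; omega) 1 0 (2 * ε) (by
        rintro _ ⟨t, ht, rfl⟩
        simp only [Set.mem_ofPred_eq, ne_eq, Fin.ext_iff] at ht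
        simp only [hs]
        split_ifs <;> first | omega | linarith)
    linarith
  have hzero : v₂ ⟨0, by omega⟩ ≤ 0 := by
    have key := le_of_mem_relaxedHull_two
      (hv₂ ⟨0, by omega⟩ (by
        simp only [ne_eq, Fin.ext_iff, Fin.val_one', Nat.mod_eq_of_lt (show 1 < d + 1 by omega)]
        omega))
      (a := ⟨0, by omega⟩) (b := ⟨1, by omega⟩) (by simp) (-1) 0 0 (by
        rintro _ ⟨t, ht, rfl⟩
        simp only [Set.mem_ofPred_eq, ne_eq, Fin.ext_iff] at ht
        simp only [hs]
        split_ifs <;> first | omega | linarith)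
    linarith
  calc 2 * ε ≤ v₁ ⟨0, by omega⟩ - v₂ ⟨0, by omega⟩ := by
        linarith [hle (d - 1) (by omega)]
    _ ≤ ‖(v₁ - v₂) ⟨0, by omega⟩‖ := le_abs_self _
    _ ≤ ‖v₁ - v₂‖ := norm_le_pi_norm _ _
end

section
/- Let d ≥ 2, let δ > 0 and ε > 0, and let x > 2dδ + ε. Let e_1,…,e_d denote the standard basis of ℝ^d, and set p_i = x·e_i for 1 ≤ i ≤ d and p_{d+1} = 0. For each j ∈ {1,…,d+1}, let S^j = {p_t : 1 ≤ t ≤ d+1, t ≠ j}, and for i ∈ {1,2} define Ψ_i as the intersection over all j ∈ {1,…,d+1} with j ≠ i of H_{(δ,∞)}(S^j). Then for every v_1 ∈ Ψ_1 and v_2 ∈ Ψ_2, ‖v_1 − v_2‖_∞ > ε. -/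
/-- If the `l`-th coordinate vanishes on `S`, it is at most `δ` on the relaxed hull of `S`. -/
lemma coord_le_of_mem_deltaHullInf {d : ℕ} {δ : ℝ} {S : Set (Fin d → ℝ)} {l : Fin d}
    (hS : ∀ w ∈ S, w l = 0) {u : Fin d → ℝ} (hu : u ∈ deltaHullInf δ S) : u l ≤ δ := by
  obtain ⟨v, hv, huv⟩ := hu
  have hvl : v l = 0 :=
    convexHull_min (t := {w : Fin d → ℝ | w l = 0}) hS
      (convex_hyperplane (LinearMap.proj (R := ℝ) (φ := fun _ : Fin d => ℝ) l).isLinear 0) hv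
  have h := (le_abs_self _).trans ((norm_le_pi_norm (u - v) l).trans huv)
  simpa [hvl] using h

/-- If the coordinates of each point of `S` sum to `c`, then on the relaxed hull of `S` they sum
to at least `c - d * δ`. -/
lemma sub_le_sum_of_mem_deltaHullInf {d : ℕ} {δ c : ℝ} {S : Set (Fin d → ℝ)}
    (hS : ∀ w ∈ S, ∑ l, w l = c) {u : Fin d → ℝ} (hu : u ∈ deltaHullInf δ S) :
    c - d * δ ≤ ∑ l, u l := by
  obtain ⟨v, hv, huv⟩ := hu
  have hlin : IsLinearMap ℝ fun w : Fin d → ℝ => ∑ l, w l :=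
    ⟨fun a b => by simp [Finset.sum_add_distrib], fun r a => by simp [Finset.mul_sum]⟩
  have hvs : ∑ l, v l = c :=
    convexHull_min (t := {w : Fin d → ℝ | ∑ l, w l = c}) hS
      (convex_hyperplane hlin c) hv
  have h : ∑ l, (v l - u l) ≤ ∑ _l : Fin d, δ := Finset.sum_le_sum fun l _ => by
    have := (neg_le_abs _).trans ((norm_le_pi_norm (u - v) l).trans huv)
    simpa using this
  simp only [Finset.sum_sub_distrib, hvs, Finset.sum_const, Finset.card_univ, Fintype.card_fin,
    nsmul_eq_mul] at h
  linarith

/-- For `d ≥ 2`, `δ > 0`, `ε > 0` and `x > 2dδ + ε`, with `p_i = x·e_i` for `i ≤ d` and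
`p_{d+1} = 0`, letting `S^j = {p_t : t ≠ j}` and `Ψ_i = ⋂_{j ≠ i} H_{(δ,∞)}(S^j)`, any
`v₁ ∈ Ψ_1` and `v₂ ∈ Ψ_2` satisfy `‖v₁ - v₂‖_∞ > ε`. -/
theorem deltaHullInf_separation (d : ℕ) (hd : 2 ≤ d) (δ ε x : ℝ)
    (hδ : 0 < δ) (hε : 0 < ε) (hx : 2 * d * δ + ε < x)
    (p : Fin (d + 1) → Fin d → ℝ)
    (hp : p = fun (i : Fin (d + 1)) (l : Fin d) => if (l : ℕ) = (i : ℕ) then x else 0)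
    (v₁ v₂ : Fin d → ℝ)
    (hv₁ : v₁ ∈ ⋂ j ∈ {j : Fin (d + 1) | j ≠ 0}, deltaHullInf δ (p '' {t | t ≠ j}))
    (hv₂ : v₂ ∈ ⋂ j ∈ {j : Fin (d + 1) | j ≠ 1}, deltaHullInf δ (p '' {t | t ≠ j})) :
    ε < ‖v₁ - v₂‖ := by
  simp only [Set.mem_iInter, Set.mem_ofPred_eq] at hv₁ hv₂
  have hcoord (l : Fin d) : ∀ w ∈ p '' {t | t ≠ l.castSucc}, w l = 0 := by
    rintro _ ⟨t, ht, rfl⟩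
    have : (l : ℕ) ≠ t := fun h => ht (Fin.ext h.symm)
    simp [hp, this]
  have hsum : ∀ w ∈ p '' {t | t ≠ Fin.last d}, ∑ l, w l = x := by
    rintro _ ⟨t, ht, rfl⟩
    obtain ⟨i, rfl⟩ := Fin.exists_castSucc_eq.mpr ht
    simp [hp, ← Fin.ext_iff]
  obtain ⟨k, rfl⟩ : ∃ k, d = k + 2 := ⟨d - 2, by omega⟩
  have h₁ : x - (k + 2 : ℕ) * δ ≤ ∑ l, v₁ l :=
    sub_le_sum_of_mem_deltaHullInf hsum (hv₁ _ (Fin.last_pos.ne'))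
  have h₂ (l : Fin (k + 1)) : v₁ l.succ ≤ δ :=
    coord_le_of_mem_deltaHullInf (hcoord _) (hv₁ _ (Fin.succ_ne_zero l.castSucc))
  have h₃ : v₂ 0 ≤ δ :=
    coord_le_of_mem_deltaHullInf (hcoord 0) (hv₂ _ (by simp))
  have h₄ : ∑ l : Fin (k + 1), v₁ l.succ ≤ ∑ _l : Fin (k + 1), δ :=
    Finset.sum_le_sum fun l _ => h₂ l
  have h₅ : v₁ 0 - v₂ 0 ≤ ‖v₁ - v₂‖ := (le_abs_self _).trans (norm_le_pi_norm (v₁ - v₂) 0)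
  rw [Fin.sum_univ_succ] at h₁
  simp only [Finset.sum_const, Finset.card_univ, Fintype.card_fin, nsmul_eq_mul] at h₄
  push_cast at h₁ h₄ hx
  linarith
end

section
/- Let d ≥ 1, f ≥ 1, δ ≥ 0 and p ∈ [1,∞]. For every finite family Y of at least (d+1)f+1 points in ℝ^d (repetitions allowed), there exists a partition of Y into f+1 nonempty sub-families Y_1,…,Y_{f+1} such that the intersection ⋂_{l=1}^{f+1} H_{(δ,p)}(Y_l) of their (δ,p)-relaxed convex hulls is nonempty. -/
open scoped ENNReal

/-- The `(δ,p)`-relaxed convex hull of `S ⊆ ℝ^d`: points within `ℓ^p`-distance `δ`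
of the convex hull of `S`.  The space `PiLp p (fun _ : Fin d => ℝ)` carries the
`ℓ^p` norm for `p ∈ [1,∞]`. -/
def deltaHullLp {d : ℕ} (p : ℝ≥0∞) [Fact (1 ≤ p)] (δ : ℝ)
    (S : Set (PiLp p (fun _ : Fin d => ℝ))) : Set (PiLp p (fun _ : Fin d => ℝ)) :=
  {u | ∃ v ∈ convexHull ℝ S, ‖u - v‖ ≤ δ}

/-- If no point of the segment from `z` to `u` is closer to the origin than `z`, then `u` lies
in the half-space `{u | ‖z‖ ^ 2 ≤ ⟪z, u⟫}`. -/
theorem norm_sq_le_inner_of_forall_norm_le {V : Type*} [NormedAddCommGroup V]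
    [InnerProductSpace ℝ V] {z u : V}
    (h : ∀ t : ℝ, 0 ≤ t → t ≤ 1 → ‖z‖ ≤ ‖(1 - t) • z + t • u‖) :
    ‖z‖ ^ 2 ≤ inner ℝ z u := by
  by_contra! hlt
  have hsub : inner ℝ z (u - z) = inner ℝ z u - ‖z‖ ^ 2 := by
    rw [inner_sub_right, real_inner_self_eq_norm_sq]
  set a : ℝ := ‖z‖ ^ 2 - inner ℝ z u with ha
  have ha0 : 0 < a := by linarith
  have hb : 0 ≤ ‖u - z‖ ^ 2 := sq_nonneg _
  set b : ℝ := ‖u - z‖ ^ 2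
  have ht0 : 0 < a / (a + b) := by positivity
  have ht1 : a / (a + b) ≤ 1 := (div_le_one (by positivity)).2 (by linarith)
  have htab : a / (a + b) * (a + b) = a := by field_simp
  set t : ℝ := a / (a + b)
  have hsq := pow_le_pow_left₀ (norm_nonneg z) (h t ht0.le ht1) 2
  have hz : (1 - t) • z + t • u = z + t • (u - z) := by module
  rw [hz, norm_add_sq_real, inner_smul_right, norm_smul, mul_pow, hsub,
    Real.norm_eq_abs, sq_abs] at hsq
  have hexp : 0 ≤ t * (t * b - 2 * a) := by
    have : inner ℝ z u - ‖z‖ ^ 2 = -a := by rw [ha]; ring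
    rw [this] at hsq
    change _ ≤ _ + t ^ 2 * b at hsq
    nlinarith
  have : 0 ≤ t * b - 2 * a := nonneg_of_mul_nonneg_right hexp ht0
  nlinarith

/-- Carathéodory reduction: a convex combination of affinely dependent points can be rewritten
so that one of the weights vanishes. -/
theorem exists_mem_stdSimplex_sum_eq_apply_eq_zero {V ι : Type*} [AddCommGroup V] [Module ℝ V]
    [Fintype ι] {v : ι → V} {w g : ι → ℝ} (hw : w ∈ stdSimplex ℝ ι)
    (hgv : ∑ i, g i • v i = 0) (hg : ∑ i, g i = 0) (hg0 : ∃ i, g i ≠ 0) :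
    ∃ w' ∈ stdSimplex ℝ ι, ∑ i, w' i • v i = ∑ i, w i • v i ∧ ∃ i, w' i = 0 := by
  obtain ⟨j, -, hj⟩ : ∃ j ∈ Finset.univ, 0 < g j :=
    Finset.exists_pos_of_sum_zero_of_exists_nonzero g hg (by simpa using hg0)
  obtain ⟨k, hk, hmin⟩ := Finset.exists_min_image (Finset.univ.filter fun i => 0 < g i)
    (fun i => w i / g i) ⟨j, by simpa using hj⟩
  have hgk : 0 < g k := by simpa using hk
  have hr : 0 ≤ w k / g k := div_nonneg (hw.1 k) hgk.le
  refine ⟨fun i => w i - w k / g k * g i, ⟨fun i => ?_, ?_⟩, ?_, k, ?_⟩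
  · rcases lt_or_ge 0 (g i) with hi | hi
    · have := (le_div_iff₀ hi).1 (hmin i (by simpa using hi))
      linarith
    · have := mul_nonpos_of_nonneg_of_nonpos hr hi
      linarith [hw.1 i]
  · rw [Finset.sum_sub_distrib, ← Finset.mul_sum, hg, hw.2]
    ring
  · simp only [sub_smul, mul_smul, Finset.sum_sub_distrib]
    rw [← Finset.smul_sum, hgv, smul_zero, sub_zero]
  · field_simp
    ring

/-- Bárány's colorful Carathéodory theorem. -/
theorem exists_colorful_sum_smul_eq_zero {V ι κ : Type*} [NormedAddCommGroup V]
    [InnerProductSpace ℝ V] [FiniteDimensional ℝ V] [Fintype ι] [Finite κ]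
    (hcard : Module.finrank ℝ V < Fintype.card ι) (x : ι → κ → V)
    (hx : ∀ i, (0 : V) ∈ convexHull ℝ (Set.range (x i))) :
    ∃ c : ι → κ, ∃ w ∈ stdSimplex ℝ ι, ∑ i, w i • x i (c i) = 0 := by
  classical
  have : Nonempty ι := Fintype.card_pos_iff.1 (by omega)
  have : Nonempty κ := Set.range_nonempty_iff_nonempty.1
    (convexHull_nonempty_iff.1 ⟨0, hx (Classical.arbitrary ι)⟩)
  have hmin (c : ι → κ) : ∃ w ∈ stdSimplex ℝ ι, ∀ w' ∈ stdSimplex ℝ ι,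
      ‖∑ i, w i • x i (c i)‖ ≤ ‖∑ i, w' i • x i (c i)‖ :=
    (isCompact_stdSimplex ℝ ι).exists_isMinOn
      ⟨_, single_mem_stdSimplex ℝ (Classical.arbitrary ι)⟩
      (by fun_prop : Continuous fun w : ι → ℝ => ‖∑ i, w i • x i (c i)‖).continuousOn
  choose W hW hWmin using hmin
  obtain ⟨c, hc⟩ := Finite.exists_min fun c : ι → κ => ‖∑ i, W c i • x i (c i)‖
  refine ⟨c, W c, hW c, ?_⟩
  set z := ∑ i, W c i • x i (c i) with hz
  have hclosest (c' : ι → κ) (w : ι → ℝ) (hw : w ∈ stdSimplex ℝ ι) :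
      ‖z‖ ≤ ‖∑ i, w i • x i (c' i)‖ := (hc c').trans (hWmin c' w hw)
  have hinner (c' : ι → κ) (w : ι → ℝ) (hw : w ∈ stdSimplex ℝ ι)
      (hwz : ∑ i, w i • x i (c' i) = z) (j : ι) : ‖z‖ ^ 2 ≤ inner ℝ z (x j (c' j)) := by
    refine norm_sq_le_inner_of_forall_norm_le fun t ht0 ht1 => ?_
    refine (hclosest c' ((1 - t) • w + t • Pi.single j 1)
      (convex_stdSimplex ℝ ι hw (single_mem_stdSimplex ℝ j) (by linarith) ht0
        (by ring))).trans_eq ?_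
    simp [add_smul, mul_smul, Finset.sum_add_distrib, ← Finset.smul_sum, hwz, Pi.single_apply]
  by_contra hz0
  have hzpos : 0 < ‖z‖ ^ 2 := by positivity
  have hreduce : ∃ w ∈ stdSimplex ℝ ι, ∑ i, w i • x i (c i) = z ∧ ∃ i, w i = 0 := by
    by_cases h0 : ∃ i, W c i = 0
    · exact ⟨W c, hW c, rfl, h0⟩
    push Not at h0
    have hle := hinner c (W c) (hW c) rfl
    have hsum : ∑ i, W c i * (inner ℝ z (x i (c i)) - ‖z‖ ^ 2) = 0 := by
      simp only [mul_sub, Finset.sum_sub_distrib]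
      rw [← Finset.sum_mul, (hW c).2, one_mul, ← real_inner_self_eq_norm_sq, sub_eq_zero]
      conv_rhs => rw [hz, inner_sum]
      simp only [inner_smul_right, ← hz]
    have heq (i : ι) : inner ℝ z (x i (c i)) = ‖z‖ ^ 2 := by
      have := (Finset.sum_eq_zero_iff_of_nonneg fun i _ =>
        mul_nonneg ((hW c).1 i) (sub_nonneg.2 (hle i))).1 hsum i (Finset.mem_univ i)
      exact sub_eq_zero.1 ((mul_eq_zero.1 this).resolve_left (h0 i))
    have hdep : ¬ LinearIndependent ℝ fun i => x i (c i) := fun h =>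
      absurd h.fintype_card_le_finrank (by omega)
    obtain ⟨g, hgv, hg0⟩ := Fintype.not_linearIndependent_iff.1 hdep
    refine exists_mem_stdSimplex_sum_eq_apply_eq_zero (hW c) hgv ?_ hg0
    have h := congrArg (inner ℝ z) hgv
    simp only [inner_sum, inner_smul_right, heq, inner_zero_right] at h
    rw [← Finset.sum_mul] at h
    exact (mul_eq_zero.1 h).resolve_right hzpos.ne'
  obtain ⟨w, hw, hwz, j, hj⟩ := hreduce
  have hhalf : convexHull ℝ (Set.range (x j)) ⊆ {u | 0 < inner ℝ z u} := by
    refine convexHull_min ?_ (convex_halfSpace_gt (innerₛₗ ℝ z).isLinear 0)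
    rintro _ ⟨k, rfl⟩
    have hswap : ∑ i, w i • x i (Function.update c j k i) = z := by
      rw [← hwz]
      refine Finset.sum_congr rfl fun i _ => ?_
      rcases eq_or_ne i j with rfl | hij
      · simp [hj]
      · simp [hij]
    have := hinner _ w hw hswap j
    rw [Function.update_self] at this
    exact hzpos.trans_le this
  simpa using hhalf (hx j)

/-- Tverberg's theorem. -/
theorem exists_iInter_convexHull_image_fiber_nonempty {E ι : Type*} [AddCommGroup E]
    [Module ℝ E] [FiniteDimensional ℝ E] [Fintype ι] (f : ℕ)
    (hcard : (Module.finrank ℝ E + 1) * f < Fintype.card ι) (y : ι → E) :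
    ∃ φ : ι → Fin (f + 1), (⋂ l, convexHull ℝ (y '' {i | φ i = l})).Nonempty := by
  classical
  let b := Module.finBasis ℝ E
  let lift (i : ι) (s : Option (Fin (Module.finrank ℝ E))) : ℝ := s.elim 1 fun s => b.repr (y i) s
  let sarkaria (k : Fin (f + 1)) (j : Fin f) : ℝ :=
    (if k = j.castSucc then 1 else 0) - if k = Fin.last f then 1 else 0
  let x (i : ι) (k : Fin (f + 1)) :
      EuclideanSpace ℝ (Option (Fin (Module.finrank ℝ E)) × Fin f) :=
    WithLp.toLp 2 fun q => lift i q.1 * sarkaria k q.2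
  have hx (i : ι) : 0 ∈ convexHull ℝ (Set.range (x i)) := by
    refine mem_convexHull_of_exists_fintype (fun _ => ((f : ℝ) + 1)⁻¹) (x i)
      (fun _ => by positivity) (by simp; field_simp) (fun k => Set.mem_range_self k) ?_
    ext q
    simp [x, sarkaria, ← Finset.mul_sum, Finset.sum_sub_distrib]
  obtain ⟨c, w, hw, hzero⟩ := exists_colorful_sum_smul_eq_zero (by simpa using hcard) x hx
  let S (k : Fin (f + 1)) : Finset ι := Finset.univ.filter fun i => c i = k
  have hcoord (s : Option (Fin (Module.finrank ℝ E))) (k : Fin (f + 1)) :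
      ∑ i ∈ S k, w i * lift i s = ∑ i ∈ S (Fin.last f), w i * lift i s := by
    induction k using Fin.lastCases with
    | last => rfl
    | cast j =>
      have h := congrFun (congrArg WithLp.ofLp hzero) (s, j)
      simp only [x, sarkaria, WithLp.ofLp_sum, WithLp.ofLp_smul, Finset.sum_apply, Pi.smul_apply,
        smul_eq_mul, mul_sub, mul_ite, mul_one, mul_zero, Finset.sum_sub_distrib,
        WithLp.ofLp_zero, Pi.zero_apply, ← Finset.sum_filter] at h
      exact sub_eq_zero.1 h
  have hpoint (k : Fin (f + 1)) :
      ∑ i ∈ S k, w i • y i = ∑ i ∈ S (Fin.last f), w i • y i := by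
    refine b.ext_elem fun s => ?_
    simpa [lift] using hcoord (some s) k
  have hweight (k : Fin (f + 1)) : ∑ i ∈ S k, w i = ∑ i ∈ S (Fin.last f), w i := by
    simpa [lift] using hcoord none k
  have hpos : 0 < ∑ i ∈ S (Fin.last f), w i := by
    have htotal : ∑ k, ∑ i ∈ S k, w i = 1 := by
      rw [← hw.2]
      exact Finset.sum_fiberwise _ _ _
    refine (Finset.sum_nonneg fun i _ => hw.1 i).lt_of_ne fun h => ?_
    simp [hweight, ← h] at htotal
  refine ⟨c, (S (Fin.last f)).centerMass w y, Set.mem_iInter.2 fun k => ?_⟩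
  have hcenter : (S (Fin.last f)).centerMass w y = (S k).centerMass w y := by
    rw [Finset.centerMass, Finset.centerMass, hweight k, hpoint k]
  rw [hcenter]
  exact Finset.centerMass_mem_convexHull _ (fun i _ => hw.1 i) (by rwa [hweight k])
    fun i hi => Set.mem_image_of_mem y (by simpa [S] using hi)

theorem subset_deltaHullLp {d : ℕ} (p : ℝ≥0∞) [Fact (1 ≤ p)] {δ : ℝ} (hδ : 0 ≤ δ)
    (S : Set (PiLp p (fun _ : Fin d => ℝ))) : convexHull ℝ S ⊆ deltaHullLp p δ S :=
  fun u hu => ⟨u, hu, by simpa using hδ⟩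



/-- `(δ,p)`-relaxed Tverberg theorem: every family of at least `(d+1)f + 1` points of
`ℝ^d` (repetitions allowed, modelled as an indexed family) can be partitioned into `f+1`
nonempty sub-families whose `(δ,p)`-relaxed convex hulls have a common point. -/
theorem deltaHullLp_tverberg (d f m : ℕ) (hd : 1 ≤ d) (hf : 1 ≤ f)
    (δ : ℝ) (hδ : 0 ≤ δ) (p : ℝ≥0∞) [Fact (1 ≤ p)]
    (hm : (d + 1) * f + 1 ≤ m)
    (y : Fin m → PiLp p (fun _ : Fin d => ℝ)) :
    ∃ φ : Fin m → Fin (f + 1), Function.Surjective φ ∧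
      (⋂ l : Fin (f + 1), deltaHullLp p δ (y '' {i | φ i = l})).Nonempty := by
  obtain ⟨φ, u, hu⟩ := exists_iInter_convexHull_image_fiber_nonempty f
    (by simpa [(WithLp.linearEquiv p ℝ (Fin d → ℝ)).finrank_eq] using hm) y
  rw [Set.mem_iInter] at hu
  refine ⟨φ, fun l => ?_, u, Set.mem_iInter.2 fun l => subset_deltaHullLp p hδ _ (hu l)⟩
  obtain ⟨_, i, hi, -⟩ := convexHull_nonempty_iff.1 ⟨u, hu l⟩
  exact ⟨i, hi⟩
end

section
/- Let d ≥ 3, f ≥ 1, 2 ≤ k ≤ d, and let n be an integer with f+1 ≤ n ≤ (d+1)f. Then there exists a family of n points in ℝ^d (repetitions allowed) such that for every partition of the family into f+1 nonempty sub-families Y_1,…,Y_{f+1}, the intersection ⋂_{l=1}^{f+1} H_k(Y_l) of their k-relaxed convex hulls is empty. Thus the bound (d+1)f+1 in the k-relaxed Tverberg statement is tight for k ≥ 2. -/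
/-- An affine inequality in two coordinates that holds on `S` holds on its `k`-relaxed convex hull
for `k ≥ 2`. -/
theorem le_of_mem_relaxedHull {d k : ℕ} (hk2 : 2 ≤ k) (hkd : k ≤ d) {S : Set (Fin d → ℝ)}
    {u : Fin d → ℝ} (hu : u ∈ relaxedHull k S) (a b : Fin d) (α β γ : ℝ)
    (h : ∀ x ∈ S, α * x a + β * x b ≤ γ) : α * u a + β * u b ≤ γ := by
  obtain ⟨D, hD, hcard⟩ := Finset.exists_superset_card_eq (s := {a, b}) (n := k)
    (Finset.card_le_two.trans hk2) (by simpa using hkd)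
  have ha : a ∈ D := hD (by simp)
  have hb : b ∈ D := hD (by simp)
  let L : (D → ℝ) →ₗ[ℝ] ℝ :=
    α • LinearMap.proj (⟨a, ha⟩ : D) + β • LinearMap.proj (⟨b, hb⟩ : D)
  have hconv : Convex ℝ {w | L w ≤ γ} := convex_halfSpace_le L.isLinear γ
  refine convexHull_min ?_ hconv (hu D hcard)
  rintro _ ⟨x, hx, rfl⟩
  exact h x hx

/-- If points are colored with `f + 1` colors, then some color is missing from each block
of indices with a given quotient by `f`. -/
theorem exists_color_avoiding_block {n f : ℕ} (hf : 1 ≤ f) (φ : Fin n → Fin (f + 1)) (c : ℕ) :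
    ∃ l, ∀ i, φ i = l → (i : ℕ) / f ≠ c := by
  by_contra! h
  choose g hg hc using h
  have hinj : Function.Injective fun l => (⟨g l % f, Nat.mod_lt _ hf⟩ : Fin f) := by
    intro l m hlm
    have hmod : (g l : ℕ) % f = g m % f := congrArg Fin.val hlm
    have heq : g l = g m := by
      apply Fin.ext
      rw [← Nat.div_add_mod (g l : ℕ) f, ← Nat.div_add_mod (g m : ℕ) f, hmod, hc, hc]
    rw [← hg l, ← hg m, heq]
  simpa using Fintype.card_le_of_injective _ hinj

/-- Tightness of the `k`-relaxed Tverberg bound for `k ≥ 2`: for `d ≥ 3`, `f ≥ 1` and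
`f + 1 ≤ n ≤ (d+1)f`, there is a family of `n` points of `ℝ^d` (repetitions allowed)
such that for every partition into `f+1` nonempty sub-families, the intersection of the
`k`-relaxed convex hulls of the parts is empty. -/
theorem relaxed_tverberg_tight (d f k n : ℕ) (hd : 3 ≤ d) (hf : 1 ≤ f)
    (hk2 : 2 ≤ k) (hkd : k ≤ d) (hn1 : f + 1 ≤ n) (hn2 : n ≤ (d + 1) * f) :
    ∃ y : Fin n → Fin d → ℝ, ∀ φ : Fin n → Fin (f + 1), Function.Surjective φ →
      (⋂ l : Fin (f + 1), relaxedHull k (y '' {i | φ i = l})) = ∅ := by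
  refine ⟨fun i j => if (i : ℕ) / f ≤ j then 1 else 0, fun φ _ => ?_⟩
  rw [Set.eq_empty_iff_forall_notMem]
  intro u hu
  rw [Set.mem_iInter] at hu
  have hnonpos : ∀ j (hj : j < d), u ⟨j, hj⟩ ≤ 0 := by
    intro j
    induction j with
    | zero =>
      intro hj
      obtain ⟨l, hl⟩ := exists_color_avoiding_block hf φ 0
      have := le_of_mem_relaxedHull hk2 hkd (hu l) ⟨0, hj⟩ ⟨0, hj⟩ 1 0 0 (by
        rintro _ ⟨i, hi, rfl⟩
        have h0 : ¬ (i : ℕ) / f ≤ 0 := fun h => hl i hi (Nat.le_zero.mp h)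
        simp only [if_neg h0]
        norm_num)
      linarith
    | succ j ih =>
      intro hj
      obtain ⟨l, hl⟩ := exists_color_avoiding_block hf φ (j + 1)
      have := le_of_mem_relaxedHull hk2 hkd (hu l) ⟨j + 1, hj⟩ ⟨j, by omega⟩ 1 (-1) 0 (by
        rintro _ ⟨i, hi, rfl⟩
        have h0 : (i : ℕ) / f ≤ j + 1 ↔ (i : ℕ) / f ≤ j := by
          have := hl i hi
          omega
        simp only [h0]
        split_ifs <;> norm_num)
      linarith [ih (by omega)]
  obtain ⟨l, hl⟩ := exists_color_avoiding_block hf φ d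
  have hlast : d - 1 < d := by omega
  have := le_of_mem_relaxedHull hk2 hkd (hu l) ⟨d - 1, hlast⟩ ⟨d - 1, hlast⟩ (-1) 0 (-1) (by
    rintro _ ⟨i, hi, rfl⟩
    have h0 : (i : ℕ) / f ≤ d - 1 := by
      have h1 : (i : ℕ) / f < d + 1 := (Nat.div_lt_iff_lt_mul hf).mpr (i.isLt.trans_le hn2)
      have := hl i hi
      omega
    simp only [if_pos h0]
    norm_num)
  linarith [hnonpos (d - 1) hlast]
end

section
/- Let d ≥ 2, f ≥ 1, let δ be a real with 0 ≤ δ < ∞, let p ∈ [1,∞], and let n be an integer with f+1 ≤ n ≤ (d+1)f. Then there exists a family of n points in ℝ^d (repetitions allowed) such that for every partition of the family into f+1 nonempty sub-families Y_1,…,Y_{f+1}, the intersection ⋂_{l=1}^{f+1} H_{(δ,p)}(Y_l) of their (δ,p)-relaxed convex hulls is empty. Thus the bound (d+1)f+1 in the (δ,p)-relaxed Tverberg statement is tight for every constant δ. -/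
open scoped ENNReal

/-- If the indices are grouped into blocks of `f` consecutive ones, then among `f + 1` classes
some class misses a given block. -/
theorem exists_class_disjoint_block {n f : ℕ} (hf : 0 < f) (φ : Fin n → Fin (f + 1)) (k : ℕ) :
    ∃ l, ∀ i, φ i = l → (i : ℕ) / f ≠ k := by
  by_contra! h
  choose g hg hk using h
  have hinj : Function.Injective fun l => (⟨(g l : ℕ) % f, Nat.mod_lt _ hf⟩ : Fin f) := by
    intro a b hab
    have hmod : (g a : ℕ) % f = (g b : ℕ) % f := congrArg Fin.val hab
    have hval : (g a : ℕ) = g b := by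
      rw [← Nat.div_add_mod (g a : ℕ) f, ← Nat.div_add_mod (g b : ℕ) f, hk, hk, hmod]
    rw [← hg a, ← hg b, Fin.ext hval]
  simpa using Fintype.card_le_of_injective _ hinj

/-- If a linear functional is constant on `S`, then each point of the relaxed hull of `S` is
coordinatewise within `δ` of a point at which the functional takes that constant value. -/
theorem exists_apply_eq_of_mem_deltaHullLp {d : ℕ} {p : ℝ≥0∞} [Fact (1 ≤ p)] {δ : ℝ}
    {S : Set (PiLp p (fun _ : Fin d => ℝ))} {u : PiLp p (fun _ : Fin d => ℝ)}
    (hu : u ∈ deltaHullLp p δ S) (L : PiLp p (fun _ : Fin d => ℝ) →ₗ[ℝ] ℝ) {c : ℝ}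
    (hL : ∀ x ∈ S, L x = c) :
    ∃ v, L v = c ∧ ∀ j, |u j - v j| ≤ δ := by
  obtain ⟨v, hv, huv⟩ := hu
  refine ⟨v, convexHull_min (t := {x | L x = c}) hL (convex_hyperplane L.isLinear c) hv,
    fun j => ?_⟩
  simpa using (PiLp.norm_apply_le (u - v) j).trans huv

/-- Tightness of the `(δ,p)`-relaxed Tverberg bound for every constant `δ ≥ 0`: for
`d ≥ 2`, `f ≥ 1` and `f + 1 ≤ n ≤ (d+1)f`, there is a family of `n` points of `ℝ^d`
(repetitions allowed) such that for every partition into `f+1` nonempty sub-families,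
the intersection of the `(δ,p)`-relaxed convex hulls of the parts is empty. -/
theorem deltaHullLp_tverberg_tight (d f n : ℕ) (hd : 2 ≤ d) (hf : 1 ≤ f)
    (δ : ℝ) (hδ : 0 ≤ δ) (p : ℝ≥0∞) [Fact (1 ≤ p)]
    (hn1 : f + 1 ≤ n) (hn2 : n ≤ (d + 1) * f) :
    ∃ y : Fin n → PiLp p (fun _ : Fin d => ℝ),
      ∀ φ : Fin n → Fin (f + 1), Function.Surjective φ →
        (⋂ l : Fin (f + 1), deltaHullLp p δ (y '' {i | φ i = l})) = ∅ := by
  set M : ℝ := 2 * d * δ + 1 with hM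
  let y : Fin n → PiLp p (fun _ : Fin d => ℝ) := fun i =>
    WithLp.toLp p fun j => if (i : ℕ) / f = j then M else 0
  refine ⟨y, fun φ _ => Set.eq_empty_iff_forall_notMem.2 fun u hu => ?_⟩
  rw [Set.mem_iInter] at hu
  have hcoord (j : Fin d) : |u j| ≤ δ := by
    obtain ⟨l, hl⟩ := exists_class_disjoint_block hf φ j
    obtain ⟨v, hv, huv⟩ := exists_apply_eq_of_mem_deltaHullLp (hu l)
      (PiLp.projₗ p (fun _ : Fin d => ℝ) j) (c := 0) (by
        rintro _ ⟨i, hi, rfl⟩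
        simp [y, hl i hi])
    have hvj : v j = 0 := hv
    simpa [hvj] using huv j
  obtain ⟨l, hl⟩ := exists_class_disjoint_block hf φ d
  obtain ⟨v, hv, huv⟩ := exists_apply_eq_of_mem_deltaHullLp (hu l)
    (∑ j, PiLp.projₗ p (fun _ : Fin d => ℝ) j) (c := M) (by
      rintro _ ⟨i, hi, rfl⟩
      have hlt : (i : ℕ) / f < d + 1 := (Nat.div_lt_iff_lt_mul hf).2 (i.2.trans_le hn2)
      have hid : (i : ℕ) / f < d := by have := hl i hi; omega
      rw [LinearMap.sum_apply, Finset.sum_eq_single ⟨(i : ℕ) / f, hid⟩]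
      · simp [y]
      · intro j _ hj
        have : (i : ℕ) / f ≠ j := fun h => hj (Fin.ext h.symm)
        simp [y, this]
      · simp)
  have hsum : ∑ j, v j = M := by simpa [LinearMap.sum_apply] using hv
  have hle : ∑ j, v j ≤ ∑ _j : Fin d, 2 * δ := Finset.sum_le_sum fun j _ => by
    linarith [(abs_le.1 (hcoord j)).2, (abs_le.1 (huv j)).1]
  rw [hsum, Finset.sum_const, Finset.card_univ, Fintype.card_fin, nsmul_eq_mul] at hle
  linarith
end

section
/- Let d ≥ 1 and let a_1,…,a_{d+1} ∈ ℝ^d be affinely independent. Let A be the d×d matrix whose i-th column is a_i − a_{d+1} for 1 ≤ i ≤ d (A is invertible), let b_i denote the i-th column of (A⁻¹)ᵀ for 1 ≤ i ≤ d, and set b_{d+1} = −(b_1 + ⋯ + b_d). Then the inradius of the simplex convexHull{a_1,…,a_{d+1}} equals 1/(∑_{i=1}^{d+1} ‖b_i‖₂), where ‖·‖₂ is the Euclidean norm. -/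
/-- The inradius of a set `C ⊆ ℝ^d`: the supremum of all `r ≥ 0` such that some closed
Euclidean ball of radius `r` is contained in `C`. -/
noncomputable def inradius {d : ℕ} (C : Set (EuclideanSpace ℝ (Fin d))) : ℝ :=
  sSup {r : ℝ | 0 ≤ r ∧ ∃ c, Metric.closedBall c r ⊆ C}

open RealInnerProductSpace in
/-- A simplex is the intersection of the half-spaces where its barycentric coordinates, the
affine functions `x ↦ ⟪b i, x⟫ + c i`, are nonnegative. -/
theorem mem_convexHull_range_iff_forall_inner_add_nonneg {ι V : Type*} [Fintype ι] [DecidableEq ι]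
    [NormedAddCommGroup V] [InnerProductSpace ℝ V] {a b : ι → V} {c : ι → ℝ}
    (hdual : ∀ i j, ⟪b i, a j⟫ + c i = if i = j then 1 else 0)
    (hsum : ∀ x, ∑ i, (⟪b i, x⟫ + c i) = 1)
    (hrepr : ∀ x, ∑ i, (⟪b i, x⟫ + c i) • a i = x) (x : V) :
    x ∈ convexHull ℝ (Set.range a) ↔ ∀ i, 0 ≤ ⟪b i, x⟫ + c i := by
  constructor
  · intro hx i
    have hconv : Convex ℝ {y : V | -c i ≤ ⟪b i, y⟫} :=
      convex_halfSpace_ge (innerₛₗ ℝ (b i)).isLinear _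
    have hsub : convexHull ℝ (Set.range a) ⊆ {y : V | -c i ≤ ⟪b i, y⟫} := by
      refine convexHull_min ?_ hconv
      rintro _ ⟨j, rfl⟩
      have h := hdual i j
      have h' : (0 : ℝ) ≤ if i = j then 1 else 0 := by positivity
      simp only [Set.mem_ofPred_eq]
      linarith
    have := hsub hx
    simp only [Set.mem_ofPred_eq] at this
    linarith
  · intro h
    rw [← hrepr x]
    exact (convex_convexHull ℝ _).sum_mem (fun i _ => h i) (hsum x)
      fun i _ => subset_convexHull ℝ _ (Set.mem_range_self i)

open RealInnerProductSpace in
/-- A closed ball lies in a half-space iff its center has enough slack. -/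
theorem closedBall_subset_setOf_inner_add_nonneg_iff {V : Type*}
    [NormedAddCommGroup V] [InnerProductSpace ℝ V] (b x : V) (c : ℝ) {r : ℝ} (hr : 0 ≤ r) :
    Metric.closedBall x r ⊆ {y | 0 ≤ ⟪b, y⟫ + c} ↔ r * ‖b‖ ≤ ⟪b, x⟫ + c := by
  constructor
  · intro h
    have hmem : x - (r / ‖b‖) • b ∈ Metric.closedBall x r := by
      rw [mem_closedBall_iff_norm, sub_sub_cancel_left, norm_neg, norm_smul, norm_div, norm_norm,
        Real.norm_of_nonneg hr]
      exact mul_le_of_le_div₀ hr (norm_nonneg b) le_rfl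
    have := h hmem
    simp only [Set.mem_ofPred_eq, inner_sub_right, inner_smul_right,
      real_inner_self_eq_norm_sq] at this
    have hb : r / ‖b‖ * ‖b‖ ^ 2 = r * ‖b‖ := by
      rcases eq_or_ne ‖b‖ 0 with h0 | h0
      · simp [h0]
      · field_simp
    linarith
  · intro h y hy
    rw [mem_closedBall_iff_norm'] at hy
    have h₁ : ⟪b, x - y⟫ ≤ ‖b‖ * r :=
      (real_inner_le_norm b _).trans (mul_le_mul_of_nonneg_left hy (norm_nonneg b))
    rw [inner_sub_right] at h₁
    simp only [Set.mem_ofPred_eq]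
    linarith

open RealInnerProductSpace in
/-- The inradius of a simplex in terms of the gradients `b i` of its barycentric coordinates. -/
theorem inradius_convexHull_eq_of_dual {ι : Type*} [Fintype ι] [DecidableEq ι] [Nontrivial ι]
    {d : ℕ} {a b : ι → EuclideanSpace ℝ (Fin d)} {c : ι → ℝ}
    (hdual : ∀ i j, ⟪b i, a j⟫ + c i = if i = j then 1 else 0)
    (hsum : ∀ x, ∑ i, (⟪b i, x⟫ + c i) = 1)
    (hrepr : ∀ x, ∑ i, (⟪b i, x⟫ + c i) • a i = x) :
    inradius (convexHull ℝ (Set.range a)) = 1 / ∑ i, ‖b i‖ := by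
  have hball : ∀ x r, 0 ≤ r → (Metric.closedBall x r ⊆ convexHull ℝ (Set.range a) ↔
      ∀ i, r * ‖b i‖ ≤ ⟪b i, x⟫ + c i) := by
    intro x r hr
    have hset : convexHull ℝ (Set.range a) = ⋂ i, {y | 0 ≤ ⟪b i, y⟫ + c i} := by
      ext y
      simpa using mem_convexHull_range_iff_forall_inner_add_nonneg hdual hsum hrepr y
    rw [hset, Set.subset_iInter_iff]
    exact forall_congr' fun i => closedBall_subset_setOf_inner_add_nonneg_iff _ _ _ hr
  have hpos : 0 < ∑ i, ‖b i‖ := by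
    obtain ⟨i, j, hij⟩ := exists_pair_ne ι
    refine Finset.sum_pos' (fun k _ => norm_nonneg _) ⟨i, Finset.mem_univ i, ?_⟩
    rw [norm_pos_iff]
    intro h0
    have h₁ := hdual i i
    have h₂ := hdual i j
    simp only [h0, inner_zero_left, zero_add, if_true, if_neg hij] at h₁ h₂
    linarith
  set S := ∑ i, ‖b i‖ with hS
  refine IsGreatest.csSup_eq ⟨⟨by positivity, ∑ j, (1 / S * ‖b j‖) • a j, ?_⟩, ?_⟩
  · rw [hball _ _ (by positivity)]
    intro i
    have hone : ∑ j, 1 / S * ‖b j‖ = 1 := by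
      rw [← Finset.mul_sum, ← hS]
      field_simp
    have : ⟪b i, ∑ j, (1 / S * ‖b j‖) • a j⟫ + c i =
        ∑ j, (1 / S * ‖b j‖) * (⟪b i, a j⟫ + c i) := by
      simp only [inner_sum, inner_smul_right, mul_add, Finset.sum_add_distrib]
      rw [← Finset.sum_mul, hone, one_mul]
    rw [this]
    simp [hdual]
  · rintro r ⟨hr, x, hx⟩
    rw [hball x r hr] at hx
    rw [le_div_iff₀ hpos, hS, Finset.mul_sum, ← hsum x]
    exact Finset.sum_le_sum fun i _ => hx i

/-- The edge matrix of a simplex is invertible. -/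
theorem AffineIndependent.isUnit_of_sub_last {d : ℕ} {a : Fin (d + 1) → EuclideanSpace ℝ (Fin d)}
    (ha : AffineIndependent ℝ a) :
    IsUnit (Matrix.of fun (j i : Fin d) => (a i.castSucc - a (Fin.last d)) j) := by
  rw [← Matrix.linearIndependent_cols_iff_isUnit]
  have h := (affineIndependent_iff_linearIndependent_vsub ℝ a (Fin.last d)).1 ha
  have h' := h.comp (fun i : Fin d => ⟨i.castSucc, (Fin.castSucc_lt_last i).ne⟩)
    fun i j hij => by simpa using hij
  exact h'.map' (WithLp.linearEquiv 2 ℝ (Fin d → ℝ)).toLinearMap (LinearEquiv.ker _)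

/-- For affinely independent `a_1, …, a_{d+1} ∈ ℝ^d`, with `A` the matrix whose `i`-th
column is `a_i - a_{d+1}`, `b_i` the `i`-th column of `(A⁻¹)ᵀ` for `i ≤ d`, and
`b_{d+1} = -(b_1 + ⋯ + b_d)`, the inradius of the simplex spanned by the `a_i` is
`1 / (∑ i ‖b_i‖₂)`. -/
theorem inradius_simplex_eq (d : ℕ) (hd : 1 ≤ d)
    (a : Fin (d + 1) → EuclideanSpace ℝ (Fin d)) (ha : AffineIndependent ℝ a)
    (A : Matrix (Fin d) (Fin d) ℝ)
    (hA : A = Matrix.of fun (j i : Fin d) => (a i.castSucc - a (Fin.last d)) j)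
    (b : Fin (d + 1) → EuclideanSpace ℝ (Fin d))
    (hb : ∀ (i : Fin d) (j : Fin d), b i.castSucc j = A⁻¹.transpose j i)
    (hblast : b (Fin.last d) = -∑ i : Fin d, b i.castSucc) :
    inradius (convexHull ℝ (Set.range a)) = 1 / ∑ i : Fin (d + 1), ‖b i‖ := by
  have hU : IsUnit A.det := (Matrix.isUnit_iff_isUnit_det A).1 (hA ▸ ha.isUnit_of_sub_last)
  have : Nontrivial (Fin (d + 1)) := Fin.nontrivial_iff_two_le.2 (by omega)
  have hinner : ∀ (i : Fin d) (x : EuclideanSpace ℝ (Fin d)),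
      inner ℝ (b i.castSucc) x = A⁻¹.mulVec x.ofLp i := by
    intro i x
    simp [PiLp.inner_apply, Matrix.mulVec, dotProduct, hb, mul_comm]
  have hcol : ∀ i j : Fin d,
      inner ℝ (b i.castSucc) (a j.castSucc - a (Fin.last d)) = if i = j then 1 else 0 := by
    intro i j
    have h := congrFun₂ (Matrix.nonsing_inv_mul A hU) i j
    rw [Matrix.one_apply] at h
    rw [hinner, ← h, Matrix.mul_apply, hA]
    rfl
  have hb0 : ∑ i, b i = 0 := by rw [Fin.sum_univ_castSucc, hblast, add_neg_cancel]
  have hexpand : ∀ v : EuclideanSpace ℝ (Fin d),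
      ∑ i : Fin d, inner ℝ (b i.castSucc) v • (a i.castSucc - a (Fin.last d)) = v := by
    intro v
    ext j
    have h : A.mulVec (A⁻¹.mulVec v.ofLp) j = v j := by
      rw [Matrix.mulVec_mulVec, Matrix.mul_nonsing_inv A hU, Matrix.one_mulVec]
    rw [← h, Matrix.mulVec, dotProduct]
    simp [hinner, hA, mul_comm]
  have hsum : ∀ x, ∑ i, (inner ℝ (b i) x +
      ((if i = Fin.last d then 1 else 0) - inner ℝ (b i) (a (Fin.last d)))) = 1 := by
    intro x
    simp [Finset.sum_add_distrib, Finset.sum_sub_distrib, ← sum_inner, hb0]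
  refine inradius_convexHull_eq_of_dual
    (c := fun i => (if i = Fin.last d then 1 else 0) - inner ℝ (b i) (a (Fin.last d)))
    ?_ hsum ?_
  · intro i j
    have key : inner ℝ (b i) (a j - a (Fin.last d)) =
        (if i = j then 1 else 0) - (if i = Fin.last d then (1 : ℝ) else 0) := by
      induction j using Fin.lastCases with
      | last => simp
      | cast j =>
        induction i using Fin.lastCases with
        | last => simp [hblast, inner_neg_left, sum_inner, hcol, (Fin.castSucc_lt_last j).ne']
        | cast i => simp [hcol, (Fin.castSucc_lt_last i).ne]
    rw [inner_sub_right] at key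
    linarith
  · intro x
    have h : ∀ i, inner ℝ (b i) x +
        ((if i = Fin.last d then 1 else 0) - inner ℝ (b i) (a (Fin.last d))) =
        inner ℝ (b i) (x - a (Fin.last d)) + if i = Fin.last d then 1 else 0 := by
      intro i
      rw [inner_sub_right]
      ring
    have hsub := hexpand (x - a (Fin.last d))
    rw [← sub_eq_zero, ← sub_eq_zero.2 hsub]
    have hlast := hsum x
    simp only [h] at hlast ⊢
    rw [Fin.sum_univ_castSucc] at hlast ⊢
    rw [← eq_sub_iff_add_eq'] at hlast
    rw [hlast]
    simp only [smul_sub, Finset.sum_sub_distrib, (Fin.castSucc_lt_last _).ne, if_false, add_zero,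
      sub_smul, one_smul, Finset.sum_smul]
    abel
end

section
/- Let d ≥ 1 and let a_1,…,a_{d+1} ∈ ℝ^d be affinely independent. Then inf over p ∈ ℝ^d of (max over k ∈ {1,…,d+1} of the Euclidean distance from p to convexHull{a_i : i ≠ k}) equals the inradius of the simplex convexHull{a_1,…,a_{d+1}}. -/
namespace Affine.Simplex

variable {V P : Type*} [NormedAddCommGroup V] [InnerProductSpace ℝ V] [MetricSpace P]
  [NormedAddTorsor V P] {n : ℕ} [NeZero n] (s : Simplex ℝ P n)

lemma signedInfDist_affineCombination_eq_mul_height (i : Fin (n + 1)) {w : Fin (n + 1) → ℝ}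
    (hw : ∑ j, w j = 1) :
    s.signedInfDist i (Finset.univ.affineCombination ℝ s.points w) = w i * s.height i := by
  rw [s.signedInfDist_affineCombination i hw, height, dist_eq_norm_vsub V]
  rfl

lemma signedInfDist_le_add_dist (i : Fin (n + 1)) (p q : P) :
    s.signedInfDist i p ≤ s.signedInfDist i q + dist p q := by
  have h := signedDist_le_dist
    (s.points i -ᵥ EuclideanGeometry.orthogonalProjection
      (affineSpan ℝ (s.points '' {i}ᶜ)) (s.points i)) q p
  rw [← signedDist_triangle_left _ ((Classical.ofNonempty : affineSpan ℝ (s.points '' {i}ᶜ)) : P) p q,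
    dist_comm] at h
  exact sub_le_iff_le_add'.1 h

/-- Moving towards the face opposite vertex `i` by `r` lowers the signed distance by `r`. -/
lemma exists_dist_eq_signedInfDist_eq_sub (i : Fin (n + 1)) (p : P) {r : ℝ} (hr : 0 ≤ r) :
    ∃ q, dist q p = r ∧ s.signedInfDist i q = s.signedInfDist i p - r := by
  set v : V := s.points i -ᵥ EuclideanGeometry.orthogonalProjection
      (affineSpan ℝ (s.points '' {i}ᶜ)) (s.points i) with hv
  have hv0 : v ≠ 0 := by
    intro h0
    have h := (s.height_pos i).ne'
    have h1 := s.signedInfDist_apply_self i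
    have h2 := AffineSubspace.signedInfDist_apply_self
      (affineSpan ℝ (s.points '' {i}ᶜ)) (s.points i)
    rw [← hv, h0, norm_zero] at h2
    rw [height, dist_eq_norm_vsub V] at h
    exact h (h1.symm.trans h2)
  have hn : ‖NormedSpace.normalize v‖ = 1 := NormedSpace.norm_normalize hv0
  refine ⟨(-r • NormedSpace.normalize v) +ᵥ p, ?_, ?_⟩
  · simp [hn, norm_smul, abs_of_nonneg hr]
  · rw [signedInfDist, AffineSubspace.signedInfDist_def, signedDist_vadd_right, ← hv,
      real_inner_smul_right, real_inner_self_eq_norm_sq, hn]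
    ring

lemma exists_weights_mul_height_eq_inradius :
    ∃ w : Fin (n + 1) → ℝ, ∑ j, w j = 1 ∧ ∀ i, w i * s.height i = s.inradius := by
  obtain ⟨w, hw, h⟩ := eq_affineCombination_of_mem_affineSpan_of_fintype
    s.incenter_mem_affineSpan_range
  refine ⟨w, hw, fun i ↦ ?_⟩
  rw [← s.signedInfDist_affineCombination_eq_mul_height i hw, ← h, signedInfDist_incenter]

variable {s}

lemma exists_inradius_le_signedInfDist {p : P} (hp : p ∈ affineSpan ℝ (Set.range s.points)) :
    ∃ i, s.inradius ≤ s.signedInfDist i p := by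
  obtain ⟨v, hv, hvr⟩ := s.exists_weights_mul_height_eq_inradius
  obtain ⟨w, hw, rfl⟩ := eq_affineCombination_of_mem_affineSpan_of_fintype hp
  obtain ⟨i, -, hi⟩ := Finset.exists_le_of_sum_le Finset.univ_nonempty (hv.trans hw.symm).le
  refine ⟨i, ?_⟩
  rw [s.signedInfDist_affineCombination_eq_mul_height i hw, ← hvr i]
  exact mul_le_mul_of_nonneg_right hi (s.height_pos i).le

lemma exists_signedInfDist_le_inradius {p : P} (hp : p ∈ affineSpan ℝ (Set.range s.points)) :
    ∃ i, s.signedInfDist i p ≤ s.inradius := by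
  obtain ⟨v, hv, hvr⟩ := s.exists_weights_mul_height_eq_inradius
  obtain ⟨w, hw, rfl⟩ := eq_affineCombination_of_mem_affineSpan_of_fintype hp
  obtain ⟨i, -, hi⟩ := Finset.exists_le_of_sum_le Finset.univ_nonempty (hw.trans hv.symm).le
  refine ⟨i, ?_⟩
  rw [s.signedInfDist_affineCombination_eq_mul_height i hw, ← hvr i]
  exact mul_le_mul_of_nonneg_right hi (s.height_pos i).le

lemma mem_closedInterior_iff_signedInfDist_nonneg {p : P}
    (hp : p ∈ affineSpan ℝ (Set.range s.points)) :
    p ∈ s.closedInterior ↔ ∀ i, 0 ≤ s.signedInfDist i p := by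
  obtain ⟨w, hw, rfl⟩ := eq_affineCombination_of_mem_affineSpan_of_fintype hp
  simp_rw [affineCombination_mem_closedInterior_iff hw,
    s.signedInfDist_affineCombination_eq_mul_height _ hw, mul_nonneg_iff_of_pos_right
    (s.height_pos _)]
  refine ⟨fun h i ↦ (h i).1, fun h i ↦ ⟨h i, ?_⟩⟩
  rw [← hw]
  exact Finset.single_le_sum (fun j _ ↦ h j) (Finset.mem_univ i)

end Affine.Simplex

namespace Affine.Simplex

variable {V : Type*} [NormedAddCommGroup V] [InnerProductSpace ℝ V] {n : ℕ} [NeZero n]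
  (s : Simplex ℝ V n)

lemma touchpoint_empty_mem_convexHull (i : Fin (n + 1)) :
    s.touchpoint ∅ i ∈ convexHull ℝ (s.points '' {j | j ≠ i}) := by
  rw [← s.affineCombination_touchpointWeights,
    Finset.affineCombination_eq_linear_combination _ _ _ (s.sum_touchpointWeights ∅ i),
    ← Finset.sum_erase (a := i) _ (by simp)]
  refine (convex_convexHull ℝ _).sum_mem (fun j hj ↦ ?_) ?_ fun j hj ↦ ?_
  · exact (s.touchpointWeights_empty_pos (Finset.ne_of_mem_erase hj).symm).le
  · rw [Finset.sum_erase _ (by simp), s.sum_touchpointWeights]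
  · exact subset_convexHull _ _ ⟨j, Finset.ne_of_mem_erase hj, rfl⟩

lemma signedInfDist_le_infDist_convexHull (i : Fin (n + 1)) (p : V) :
    s.signedInfDist i p ≤ Metric.infDist p (convexHull ℝ (s.points '' {j | j ≠ i})) := by
  refine (Metric.le_infDist ⟨_, s.touchpoint_empty_mem_convexHull i⟩).2 fun q hq ↦ ?_
  have h0 : s.signedInfDist i q = 0 :=
    AffineSubspace.signedInfDist_apply_of_mem _ (convexHull_subset_affineSpan _ hq)
  simpa [h0] using s.signedInfDist_le_add_dist i p q

lemma infDist_incenter_convexHull (i : Fin (n + 1)) :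
    Metric.infDist s.incenter (convexHull ℝ (s.points '' {j | j ≠ i})) = s.inradius := by
  refine le_antisymm ?_ ?_
  · exact (Metric.infDist_le_dist_of_mem (s.touchpoint_empty_mem_convexHull i)).trans_eq
      (s.dist_incenter i)
  · rw [← s.signedInfDist_incenter i]
    exact s.signedInfDist_le_infDist_convexHull i _

variable {s}

lemma closedBall_incenter_subset_convexHull (hs : affineSpan ℝ (Set.range s.points) = ⊤) :
    Metric.closedBall s.incenter s.inradius ⊆ convexHull ℝ (Set.range s.points) := by
  intro p hp
  rw [convexHull_eq_closedInterior, mem_closedInterior_iff_signedInfDist_nonneg (by simp [hs])]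
  intro i
  have h := s.signedInfDist_le_add_dist i s.incenter p
  rw [s.signedInfDist_incenter, dist_comm] at h
  linarith [Metric.mem_closedBall.1 hp]

lemma le_inradius_of_closedBall_subset_convexHull (hs : affineSpan ℝ (Set.range s.points) = ⊤)
    {c : V} {r : ℝ} (hr : 0 ≤ r)
    (h : Metric.closedBall c r ⊆ convexHull ℝ (Set.range s.points)) : r ≤ s.inradius := by
  obtain ⟨i, hi⟩ := exists_signedInfDist_le_inradius (s := s) (p := c) (by simp [hs])
  obtain ⟨q, hqc, hq⟩ := s.exists_dist_eq_signedInfDist_eq_sub i c hr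
  have hmem := h (Metric.mem_closedBall.2 hqc.le)
  rw [convexHull_eq_closedInterior, mem_closedInterior_iff_signedInfDist_nonneg (by simp [hs])]
    at hmem
  linarith [hmem i]

end Affine.Simplex

/-- For affinely independent `a_1, …, a_{d+1} ∈ ℝ^d`, the infimum over points `p` of the
maximal Euclidean distance from `p` to the facet hulls `convexHull {a_i : i ≠ k}` equals
the inradius of the simplex `convexHull {a_1, …, a_{d+1}}`. -/
theorem iInf_iSup_facet_dist_eq_inradius (d : ℕ) (hd : 1 ≤ d)
    (a : Fin (d + 1) → EuclideanSpace ℝ (Fin d)) (ha : AffineIndependent ℝ a) :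
    (⨅ p : EuclideanSpace ℝ (Fin d), ⨆ k : Fin (d + 1),
        Metric.infDist p (convexHull ℝ (a '' {i | i ≠ k})))
      = inradius (convexHull ℝ (Set.range a)) := by
  have : NeZero d := ⟨by omega⟩
  let s : Affine.Simplex ℝ (EuclideanSpace ℝ (Fin d)) d := ⟨a, ha⟩
  have hs : affineSpan ℝ (Set.range s.points) = ⊤ :=
    ha.affineSpan_eq_top_iff_card_eq_finrank_add_one.2 (by simp)
  have hC : inradius (convexHull ℝ (Set.range a)) = s.inradius :=
    IsGreatest.csSup_eq
      ⟨⟨s.inradius_pos.le, _, Affine.Simplex.closedBall_incenter_subset_convexHull hs⟩,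
        fun _ ⟨hr, _, hc⟩ ↦ Affine.Simplex.le_inradius_of_closedBall_subset_convexHull hs hr hc⟩
  have hge (p : EuclideanSpace ℝ (Fin d)) :
      s.inradius ≤ ⨆ k, Metric.infDist p (convexHull ℝ (a '' {i | i ≠ k})) := by
    obtain ⟨k, hk⟩ := Affine.Simplex.exists_inradius_le_signedInfDist (s := s) (p := p)
      (by simp [hs])
    exact (hk.trans (s.signedInfDist_le_infDist_convexHull k p)).trans
      (le_ciSup (f := fun k ↦ Metric.infDist p (convexHull ℝ (a '' {i | i ≠ k})))
        (Set.finite_range _).bddAbove k)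
  rw [hC]
  refine le_antisymm ?_ (le_ciInf hge)
  exact (ciInf_le ⟨s.inradius, Set.forall_mem_range.2 hge⟩ s.incenter).trans
    (ciSup_le fun k ↦ (s.infDist_incenter_convexHull k).le)
end

section
/- Let d ≥ 2 and let a_1,…,a_{d+1} ∈ ℝ^d be affinely independent, and let r be the inradius of the simplex convexHull{a_1,…,a_{d+1}}. For each k ∈ {1,…,d+1}, let r_k be the inradius of the facet convexHull{a_i : i ≠ k} within its (d−1)-dimensional affine span, i.e. the supremum of all ρ ≥ 0 such that there exists a point p in the affine span of {a_i : i ≠ k} with the property that every point of that affine span at Euclidean distance at most ρ from p lies in convexHull{a_i : i ≠ k}. Then r < min_{1 ≤ k ≤ d+1} r_k. -/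
/-- The inradius of a facet of a simplex, within the affine span of the facet:
the supremum of all `ρ ≥ 0` such that some point `p` of the affine span has the
property that every point of the affine span at distance at most `ρ` of `p`
belongs to the facet. -/
noncomputable def facetInradius {d : ℕ} (F : Set (EuclideanSpace ℝ (Fin d))) : ℝ :=
  sSup {ρ : ℝ | 0 ≤ ρ ∧ ∃ p ∈ affineSpan ℝ F,
    ∀ q ∈ affineSpan ℝ F, dist q p ≤ ρ → q ∈ convexHull ℝ F}

/-- A point whose `k`-th barycentric coordinate vanishes and whose other coordinates are
nonnegative lies in the facet opposite to the `k`-th vertex. -/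
theorem AffineBasis.mem_convexHull_facet {ι V : Type*} [Fintype ι] [AddCommGroup V] [Module ℝ V]
    (b : AffineBasis ι ℝ V) (k : ι) {q : V} (hk : b.coord k q = 0)
    (hq : ∀ i, 0 ≤ b.coord i q) : q ∈ convexHull ℝ (b '' {i | i ≠ k}) := by
  classical
  have hsum := b.sum_coord_apply_eq_one q
  have hq' := b.linear_combination_coord_eq_self q
  rw [← Finset.add_sum_erase _ _ (Finset.mem_univ k), hk, zero_add] at hsum
  rw [← Finset.add_sum_erase _ _ (Finset.mem_univ k), hk, zero_smul, zero_add] at hq'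
  rw [← hq']
  exact (convex_convexHull ℝ _).sum_mem (fun i _ => hq i) hsum
    fun i hi => subset_convexHull ℝ _ ⟨i, Finset.ne_of_mem_erase hi, rfl⟩

/-- The `k`-th barycentric coordinate vanishes on the affine span of the opposite facet. -/
theorem AffineBasis.coord_eq_zero_of_mem_affineSpan_facet {ι V : Type*} [AddCommGroup V]
    [Module ℝ V] (b : AffineBasis ι ℝ V) (k : ι) {q : V}
    (hq : q ∈ affineSpan ℝ (b '' {i | i ≠ k})) : b.coord k q = 0 := by
  have h : affineSpan ℝ (b '' {i | i ≠ k}) ≤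
      (AffineSubspace.mk' (0 : ℝ) ⊥).comap (b.coord k) := by
    rw [affineSpan_le]
    rintro _ ⟨i, hi, rfl⟩
    simp [AffineSubspace.mem_mk', b.coord_apply_ne (Ne.symm hi)]
  simpa [AffineSubspace.mem_mk'] using h hq

/-- The radii competing in the definition of `facetInradius` are bounded above as soon as the
facet is bounded and has two distinct points. -/
theorem bddAbove_facet_radii {d : ℕ} {F : Set (EuclideanSpace ℝ (Fin d))}
    (hF : Bornology.IsBounded F) (hF' : F.Nontrivial) :
    BddAbove {ρ : ℝ | 0 ≤ ρ ∧ ∃ p ∈ affineSpan ℝ F,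
      ∀ q ∈ affineSpan ℝ F, dist q p ≤ ρ → q ∈ convexHull ℝ F} := by
  obtain ⟨x, hx, y, hy, hxy⟩ := hF'
  refine ⟨Metric.diam (convexHull ℝ F), ?_⟩
  rintro ρ ⟨hρ, p, hp, h⟩
  have hn : ‖x - y‖ ≠ 0 := norm_ne_zero_iff.2 (sub_ne_zero.2 hxy)
  have hmem : (ρ / ‖x - y‖) • (x - y) + p ∈ affineSpan ℝ F :=
    AffineSubspace.vadd_mem_of_mem_direction (Submodule.smul_mem _ _
      (AffineSubspace.vsub_mem_direction (subset_affineSpan ℝ F hx)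
        (subset_affineSpan ℝ F hy))) hp
  have hdist : dist ((ρ / ‖x - y‖) • (x - y) + p) p = ρ := by
    rw [dist_eq_norm, add_sub_cancel_right, norm_smul, norm_div, norm_norm,
      div_mul_cancel₀ _ hn, Real.norm_of_nonneg hρ]
  calc ρ = dist ((ρ / ‖x - y‖) • (x - y) + p) p := hdist.symm
    _ ≤ _ := Metric.dist_le_diam_of_mem (isBounded_convexHull.2 hF) (h _ hmem hdist.le)
      (h _ hp (by simpa using hρ))

/-- A ball of radius `ρ` inside a simplex yields, by a homothety centred at the vertex `b k`, a ball
of radius larger than `ρ` inside the opposite facet. -/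
theorem AffineBasis.radius_mul_le_facetInradius {d : ℕ}
    (b : AffineBasis (Fin (d + 1)) ℝ (EuclideanSpace ℝ (Fin d))) (hd : 2 ≤ d)
    {j k : Fin (d + 1)} (hjk : j ≠ k) {ρ : ℝ} (hρ : 0 < ρ) {c : EuclideanSpace ℝ (Fin d)}
    (hc : Metric.closedBall c ρ ⊆ convexHull ℝ (Set.range b)) :
    ρ * (1 + ‖b k - b j‖⁻¹ * facetInradius (b '' {i | i ≠ k})) ≤
      facetInradius (b '' {i | i ≠ k}) := by
  have hn : 0 < ‖b k - b j‖ :=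
    norm_pos_iff.2 (sub_ne_zero.2 (b.ind.injective.ne hjk.symm))
  set δ := ‖b k - b j‖⁻¹ with hδ
  have hδ0 : 0 < δ := inv_pos.2 hn
  have hcoord : ∀ x, dist x c ≤ ρ → ∀ i, 0 ≤ b.coord i x := by
    intro x hx
    have := hc (Metric.mem_closedBall.2 hx)
    rwa [b.convexHull_eq_nonneg_coord] at this
  have hle1 : ∀ x, dist x c ≤ ρ → b.coord k x ≤ 1 := by
    intro x hx
    rw [← b.sum_coord_apply_eq_one x]
    exact Finset.single_le_sum (fun i _ => hcoord x hx i) (Finset.mem_univ k)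
  have hlin : ∀ t : ℝ, b.coord k (t • (b k - b j) + c) = t + b.coord k c := by
    intro t
    have h1 : (b.coord k).linear (b k - b j) = 1 := by
      have := (b.coord k).linearMap_vsub (b k) (b j)
      rwa [b.coord_apply_eq, b.coord_apply_ne hjk.symm, vsub_eq_sub, vsub_eq_sub,
        sub_zero] at this
    have := (b.coord k).map_vadd c (t • (b k - b j))
    rwa [map_smul, h1, smul_eq_mul, mul_one, vadd_eq_add, vadd_eq_add] at this
  have hdist : ∀ t : ℝ, |t| = ρ * δ → dist (t • (b k - b j) + c) c ≤ ρ := by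
    intro t ht
    rw [dist_eq_norm, add_sub_cancel_right, norm_smul, Real.norm_eq_abs, ht, hδ, mul_assoc,
      inv_mul_cancel₀ hn.ne', mul_one]
  set w := b.coord k c with hw
  have hρδ : 0 < ρ * δ := mul_pos hρ hδ0
  have hw0 : ρ * δ ≤ w := by
    have := hcoord _ (hdist (-(ρ * δ)) (by rw [abs_neg, abs_of_pos hρδ])) k
    rw [hlin] at this
    linarith
  have hw1 : w < 1 := by
    have := hle1 _ (hdist (ρ * δ) (abs_of_pos hρδ))
    rw [hlin] at this
    linarith
  have hw1' : 0 < 1 - w := by linarith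
  have hcc : ∀ i, 0 ≤ b.coord i c := hcoord c (by simpa using hρ.le)
  have hne : (1 - w) ≠ 0 := hw1'.ne'
  set p := AffineMap.lineMap (b k) c (1 - w)⁻¹ with hp
  have hpc : AffineMap.lineMap p (b k) w = c := by
    simp only [hp, AffineMap.lineMap_apply_module]
    match_scalars <;> field_simp
    ring
  have hpk : b.coord k p = 0 := by
    rw [hp, AffineMap.apply_lineMap, ← hw, b.coord_apply_eq, AffineMap.lineMap_apply_module]
    simp only [smul_eq_mul]
    field_simp
    ring
  have hpF : p ∈ convexHull ℝ (b '' {i | i ≠ k}) := by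
    refine b.mem_convexHull_facet k hpk fun i => ?_
    obtain rfl | hi := eq_or_ne i k
    · exact hpk.ge
    · rw [hp, AffineMap.apply_lineMap, b.coord_apply_ne hi, AffineMap.lineMap_apply_module]
      simpa using mul_nonneg (inv_nonneg.2 hw1'.le) (hcc i)
  have key : ρ / (1 - w) ≤ facetInradius (b '' {i | i ≠ k}) := by
    refine le_csSup (bddAbove_facet_radii (Set.toFinite _).isBounded ?_)
      ⟨(div_pos hρ hw1').le, p, convexHull_subset_affineSpan _ hpF, fun q hq hqp => ?_⟩
    · obtain ⟨l, hl⟩ : ∃ l, l ∉ ({j, k} : Finset (Fin (d + 1))) := by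
        by_contra! h
        have h1 := Finset.card_le_card (fun x _ => h x : Finset.univ ⊆ _)
        have h2 := Finset.card_le_two (a := j) (b := k)
        rw [Finset.card_univ, Fintype.card_fin] at h1
        omega
      simp only [Finset.mem_insert, Finset.mem_singleton, not_or] at hl
      exact ⟨b j, ⟨j, hjk, rfl⟩, b l, ⟨l, hl.2, rfl⟩, b.ind.injective.ne (Ne.symm hl.1)⟩
    · have hqk := b.coord_eq_zero_of_mem_affineSpan_facet k hq
      have hqc : dist (AffineMap.lineMap q (b k) w) c ≤ ρ := by
        rw [← hpc]
        have : (AffineMap.lineMap q (b k) w : EuclideanSpace ℝ (Fin d)) -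
            AffineMap.lineMap p (b k) w = (1 - w) • (q - p) := by
          simp only [AffineMap.lineMap_apply_module]
          module
        rw [dist_eq_norm, this, norm_smul, Real.norm_of_nonneg hw1'.le, ← dist_eq_norm]
        rw [le_div_iff₀ hw1'] at hqp
        linarith
      refine b.mem_convexHull_facet k hqk fun i => ?_
      obtain rfl | hi := eq_or_ne i k
      · exact hqk.ge
      · have := hcoord _ hqc i
        rw [AffineMap.apply_lineMap, b.coord_apply_ne hi, AffineMap.lineMap_apply_module] at this
        simp only [smul_eq_mul, mul_zero, add_zero] at this
        exact nonneg_of_mul_nonneg_right this hw1'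
  have hR : 0 ≤ facetInradius (b '' {i | i ≠ k}) := (div_pos hρ hw1').le.trans key
  rw [div_le_iff₀ hw1'] at key
  nlinarith [mul_le_mul_of_nonneg_right hw0 hR]

/-- For `d ≥ 2` and affinely independent `a_1, …, a_{d+1} ∈ ℝ^d`, the inradius `r` of the
simplex is strictly smaller than the minimum over `k` of the inradius `r_k` of the `k`-th
facet `convexHull {a_i : i ≠ k}` computed within its `(d-1)`-dimensional affine span. -/
theorem inradius_lt_min_facet_inradius (d : ℕ) (hd : 2 ≤ d)
    (a : Fin (d + 1) → EuclideanSpace ℝ (Fin d)) (ha : AffineIndependent ℝ a) :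
    inradius (convexHull ℝ (Set.range a)) <
      ⨅ k : Fin (d + 1), facetInradius (a '' {i | i ≠ k}) := by
  obtain ⟨k, hk⟩ := exists_eq_ciInf_of_finite
    (f := fun k : Fin (d + 1) => facetInradius (a '' {i | i ≠ k}))
  rw [← hk]
  let b : AffineBasis (Fin (d + 1)) ℝ (EuclideanSpace ℝ (Fin d)) :=
    ⟨a, ha, ha.affineSpan_eq_top_iff_card_eq_finrank_add_one.2 (by simp)⟩
  change inradius (convexHull ℝ (Set.range b)) < facetInradius (b '' {i | i ≠ k})
  have : Nontrivial (Fin (d + 1)) := Fin.nontrivial_iff_two_le.2 (by omega)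
  obtain ⟨j, hjk⟩ := exists_ne k
  have hδ : 0 < ‖b k - b j‖⁻¹ :=
    inv_pos.2 (norm_pos_iff.2 (sub_ne_zero.2 (b.ind.injective.ne hjk.symm)))
  have hR : 0 < facetInradius (b '' {i | i ≠ k}) := by
    obtain ⟨c, hc⟩ := interior_convexHull_nonempty_iff_affineSpan_eq_top.2 b.tot
    obtain ⟨ρ, hρ, hcρ⟩ := Metric.nhds_basis_closedBall.mem_iff.1 (mem_interior_iff_mem_nhds.1 hc)
    have h := b.radius_mul_le_facetInradius hd hjk hρ hcρ
    have h0 : 0 ≤ facetInradius (b '' {i | i ≠ k}) := Real.sSup_nonneg fun _ hx => hx.1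
    exact lt_of_lt_of_le (by positivity) h
  have hpos : 0 < 1 + ‖b k - b j‖⁻¹ * facetInradius (b '' {i | i ≠ k}) := by positivity
  calc inradius (convexHull ℝ (Set.range b))
      ≤ facetInradius (b '' {i | i ≠ k}) /
          (1 + ‖b k - b j‖⁻¹ * facetInradius (b '' {i | i ≠ k})) := by
        refine Real.sSup_le ?_ (by positivity)
        rintro ρ ⟨hρ, c, hc⟩
        obtain rfl | hρ := hρ.eq_or_lt
        · positivity
        · exact (le_div_iff₀ hpos).2 (b.radius_mul_le_facetInradius hd hjk hρ hc)
    _ < facetInradius (b '' {i | i ≠ k}) :=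
        div_lt_self hR (by linarith [mul_pos hδ hR])
end

section
/- Let d ≥ 1 and let a_1,…,a_{d+1} ∈ ℝ^d be affinely independent, and let r be the inradius of the simplex convexHull{a_1,…,a_{d+1}}. Then r < (max over 1 ≤ i < j ≤ d+1 of ‖a_i − a_j‖₂)/d, where ‖·‖₂ is the Euclidean norm; that is, the inradius is strictly less than the maximum edge length of the simplex divided by d. -/
/-- A closed ball of radius `r` contained in a simplex whose vertices have pairwise distance at
most `L` satisfies `(number of vertices) * r ≤ L`. -/
theorem AffineBasis.card_mul_radius_le_of_closedBall_subset {ι E : Type*} [Fintype ι]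
    [Nontrivial ι] [NormedAddCommGroup E] [NormedSpace ℝ E] (b : AffineBasis ι ℝ E) {L r : ℝ}
    (hL : 0 < L) (hb : ∀ i j, dist (b i) (b j) ≤ L) (hr : 0 ≤ r) {c : E}
    (hc : Metric.closedBall c r ⊆ convexHull ℝ (Set.range b)) :
    Fintype.card ι * r ≤ L := by
  have key : ∀ i, r / L ≤ b.coord i c := by
    intro i
    obtain ⟨j, hij⟩ := exists_ne i
    have hp : (r / L) • (b j - b i) +ᵥ c ∈ Metric.closedBall c r := by
      rw [Metric.mem_closedBall, dist_eq_norm, vadd_eq_add, add_sub_cancel_right, norm_smul,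
        ← dist_eq_norm, Real.norm_of_nonneg (by positivity)]
      calc r / L * dist (b j) (b i) ≤ r / L * L := by gcongr; exact hb j i
        _ = r := div_mul_cancel₀ r hL.ne'
    have hnonneg := hc hp
    rw [b.convexHull_eq_nonneg_coord] at hnonneg
    have hi := hnonneg i
    have hlin : (b.coord i).linear (b j - b i) = -1 := by
      have h := (b.coord i).linearMap_vsub (b j) (b i)
      rw [vsub_eq_sub] at h
      rw [h, b.coord_apply_ne hij.symm, b.coord_apply_eq, vsub_eq_sub, zero_sub]
    rw [AffineMap.map_vadd, map_smul, hlin, vadd_eq_add, smul_eq_mul] at hi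
    linarith
  have hsum : ∑ _i : ι, r / L ≤ ∑ i, b.coord i c := Finset.sum_le_sum fun i _ => key i
  rw [b.sum_coord_apply_eq_one, Finset.sum_const, Finset.card_univ, nsmul_eq_mul,
    ← mul_div_assoc, div_le_one hL] at hsum
  exact hsum

/-- For affinely independent `a_1, …, a_{d+1} ∈ ℝ^d`, the inradius of the simplex
`convexHull {a_1, …, a_{d+1}}` is strictly less than the maximum edge length
`max_{i ≠ j} ‖a_i - a_j‖₂` divided by `d`. -/
theorem inradius_lt_max_edge_div_dim (d : ℕ) (hd : 1 ≤ d)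
    (a : Fin (d + 1) → EuclideanSpace ℝ (Fin d)) (ha : AffineIndependent ℝ a) :
    inradius (convexHull ℝ (Set.range a)) <
      (⨆ q : {q : Fin (d + 1) × Fin (d + 1) // q.1 ≠ q.2},
        dist (a q.1.1) (a q.1.2)) / d := by
  set L := ⨆ q : {q : Fin (d + 1) × Fin (d + 1) // q.1 ≠ q.2}, dist (a q.1.1) (a q.1.2)
  have hdist : ∀ i j, i ≠ j → dist (a i) (a j) ≤ L := fun i j hij =>
    le_ciSup (f := fun q : {q : Fin (d + 1) × Fin (d + 1) // q.1 ≠ q.2} =>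
      dist (a q.1.1) (a q.1.2)) (Set.finite_range _).bddAbove ⟨(i, j), hij⟩
  have : Nontrivial (Fin (d + 1)) := Fin.nontrivial_iff_two_le.2 (by omega)
  have hL : 0 < L := by
    obtain ⟨i, j, hij⟩ := exists_pair_ne (Fin (d + 1))
    exact (dist_pos.2 (ha.injective.ne hij)).trans_le (hdist i j hij)
  have hd0 : (0 : ℝ) < d := by exact_mod_cast hd
  let b : AffineBasis (Fin (d + 1)) ℝ (EuclideanSpace ℝ (Fin d)) :=
    ⟨a, ha, ha.affineSpan_eq_top_iff_card_eq_finrank_add_one.2 (by simp)⟩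
  have hle : inradius (convexHull ℝ (Set.range a)) ≤ L / (d + 1) := by
    refine Real.sSup_le ?_ (by positivity)
    rintro r ⟨hr, c, hc⟩
    have h := b.card_mul_radius_le_of_closedBall_subset hL (fun i j => ?_) hr hc
    · rw [Fintype.card_fin, Nat.cast_add, Nat.cast_one] at h
      rw [le_div_iff₀ (by positivity)]
      linarith
    · rcases eq_or_ne i j with rfl | hij
      · simpa using hL.le
      · exact hdist i j hij
  exact hle.trans_lt (div_lt_div_of_pos_left hL hd0 (lt_add_one _))
end

section
/- Let d ≥ 3, let n be an integer with 4 ≤ n ≤ d+1, and let a_1,…,a_n ∈ ℝ^d be affinely independent (equivalently, the vectors a_i − a_n for 1 ≤ i ≤ n−1 are linearly independent). Define δ* = inf over p ∈ ℝ^d of (max over i ∈ {1,…,n} of the Euclidean distance from p to convexHull{a_t : t ≠ i}). Then (1) δ* < (min over pairs s ≠ t of ‖a_s − a_t‖₂)/2, and (2) for every index j ∈ {1,…,n}, δ* < (max over pairs s ≠ t with s ≠ j and t ≠ j of ‖a_s − a_t‖₂)/(n − 2). -/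
namespace Affine.Simplex

variable {V P : Type*} [NormedAddCommGroup V] [InnerProductSpace ℝ V] [MetricSpace P]
  [NormedAddTorsor V P] {n : ℕ} [NeZero n]

lemma height_le_dist (s : Simplex ℝ P n) {i j : Fin (n + 1)} (hij : i ≠ j) :
    s.height i ≤ dist (s.points i) (s.points j) := by
  have h := s.inner_vsub_vsub_altitudeFoot_eq_height_sq hij
  have hcs := real_inner_le_norm (s.points i -ᵥ s.points j) (s.points i -ᵥ s.altitudeFoot i)
  rw [h, ← dist_eq_norm_vsub, ← dist_eq_norm_vsub, sq] at hcs
  exact le_of_mul_le_mul_right hcs (s.height_pos i)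

lemma inradius_mul_sum_inv_height (s : Simplex ℝ P n) :
    s.inradius * ∑ i, (s.height i)⁻¹ = 1 := by
  have h := s.sum_excenterWeightsUnnorm_empty_pos
  rw [inradius_eq_abs_inv_sum, abs_of_pos (inv_pos.2 h)]
  simp only [excenterWeightsUnnorm_empty_apply] at h ⊢
  exact inv_mul_cancel₀ h.ne'

/-- If the heights from the vertices in `I` are at most `M`, then `#I` times the inradius is at most
`M` times the sum of the ratios of the inradius to these heights. -/
lemma card_mul_inradius_le (s : Simplex ℝ P n) (I : Finset (Fin (n + 1))) {M : ℝ}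
    (hM : ∀ i ∈ I, s.height i ≤ M) :
    I.card * s.inradius ≤ M * ∑ i ∈ I, s.inradius / s.height i := by
  rw [Finset.mul_sum, ← nsmul_eq_mul]
  refine Finset.card_nsmul_le_sum _ _ _ fun i hi ↦ ?_
  have h := s.height_pos i
  rw [← mul_div_assoc, le_div_iff₀ h, mul_comm M]
  exact mul_le_mul_of_nonneg_left (hM i hi) s.inradius_pos.le

/-- If the heights from a proper subset `I` of the vertices are at most `M`, then the inradius is
less than `M / #I`. -/
lemma card_mul_inradius_lt (s : Simplex ℝ P n) {I : Finset (Fin (n + 1))} {M : ℝ} (hM₀ : 0 < M)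
    (hI : I ≠ Finset.univ) (hM : ∀ i ∈ I, s.height i ≤ M) : I.card * s.inradius < M := by
  refine (s.card_mul_inradius_le I hM).trans_lt (mul_lt_of_lt_one_right hM₀ ?_)
  obtain ⟨j, hj⟩ : ∃ j, j ∉ I := by simpa [Finset.eq_univ_iff_forall] using hI
  have hpos (i) : 0 < s.inradius / s.height i := div_pos s.inradius_pos (s.height_pos i)
  calc ∑ i ∈ I, s.inradius / s.height i < ∑ i, s.inradius / s.height i :=
        Finset.sum_lt_sum_of_subset (Finset.subset_univ I) (Finset.mem_univ j) hj (hpos j)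
          fun i _ _ ↦ (hpos i).le
    _ = 1 := by simp_rw [div_eq_mul_inv, ← Finset.mul_sum, s.inradius_mul_sum_inv_height]

lemma infDist_incenter_convexHull_le [Nat.AtLeastTwo n] (s : Simplex ℝ V n) (i : Fin (n + 1)) :
    Metric.infDist s.incenter (convexHull ℝ (s.points '' {t | t ≠ i})) ≤ s.inradius := by
  rw [← s.dist_incenter i]
  refine Metric.infDist_le_dist_of_mem ?_
  have : NeZero (n - 1) := Nat.AtLeastTwo.neZero_sub_one n
  have h := (s.faceOpposite i).interior_subset_closedInterior
    (s.touchpoint_empty_mem_interior_faceOpposite i)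
  rwa [← convexHull_eq_closedInterior, range_faceOpposite_points] at h

lemma iInf_iSup_infDist_convexHull_le_inradius [Nat.AtLeastTwo n] (s : Simplex ℝ V n) :
    ⨅ p : V, ⨆ i, Metric.infDist p (convexHull ℝ (s.points '' {t | t ≠ i})) ≤ s.inradius :=
  ciInf_le_of_le ⟨0, by rintro _ ⟨p, rfl⟩; exact Real.iSup_nonneg fun _ ↦ Metric.infDist_nonneg⟩
    s.incenter (ciSup_le s.infDist_incenter_convexHull_le)

end Affine.Simplex

/-- For `d ≥ 3`, `4 ≤ n ≤ d+1`, and affinely independent inputs `a_1, …, a_n ∈ ℝ^d`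
(Euclidean norm), the optimal relaxation parameter
`δ* = inf_p max_i dist(p, convexHull {a_t : t ≠ i})` satisfies
(1) `δ* < (min_{s ≠ t} ‖a_s - a_t‖₂) / 2`, and
(2) for every `j`, `δ* < (max_{s ≠ t, s ≠ j, t ≠ j} ‖a_s - a_t‖₂) / (n - 2)`. -/
theorem deltaStar_bounds_f_one (d n : ℕ) (hd : 3 ≤ d) (hn1 : 4 ≤ n) (hn2 : n ≤ d + 1)
    (a : Fin n → EuclideanSpace ℝ (Fin d)) (ha : AffineIndependent ℝ a) :
    (⨅ p : EuclideanSpace ℝ (Fin d), ⨆ i : Fin n,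
        Metric.infDist p (convexHull ℝ (a '' {t | t ≠ i}))) <
      (⨅ q : {q : Fin n × Fin n // q.1 ≠ q.2}, dist (a q.1.1) (a q.1.2)) / 2 ∧
    ∀ j : Fin n,
      (⨅ p : EuclideanSpace ℝ (Fin d), ⨆ i : Fin n,
          Metric.infDist p (convexHull ℝ (a '' {t | t ≠ i}))) <
        (⨆ q : {q : Fin n × Fin n // q.1 ≠ q.2 ∧ q.1 ≠ j ∧ q.2 ≠ j},
            dist (a q.1.1) (a q.1.2)) / ((n : ℝ) - 2) := by
  obtain ⟨m, rfl⟩ : ∃ m, n = m + 1 := ⟨n - 1, by lia⟩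
  have : Nat.AtLeastTwo m := ⟨by lia⟩
  have : NeZero m := ⟨by lia⟩
  let s : Affine.Simplex ℝ (EuclideanSpace ℝ (Fin d)) m := ⟨a, ha⟩
  have hle := s.iInf_iSup_infDist_convexHull_le_inradius
  refine ⟨hle.trans_lt ?_, fun j ↦ hle.trans_lt ?_⟩
  · have : Nonempty {q : Fin (m + 1) × Fin (m + 1) // q.1 ≠ q.2} :=
      ⟨⟨(⟨0, by lia⟩, ⟨1, by lia⟩), by simp⟩⟩
    obtain ⟨⟨⟨i, k⟩, hik⟩, hq⟩ := exists_eq_ciInf_of_finite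
      (f := fun q : {q : Fin (m + 1) × Fin (m + 1) // q.1 ≠ q.2} ↦ dist (a q.1.1) (a q.1.2))
    rw [← hq, lt_div_iff₀ two_pos, mul_comm]
    have hcard : ({i, k} : Finset (Fin (m + 1))).card = 2 := Finset.card_pair hik
    have h := s.card_mul_inradius_lt (I := {i, k}) (M := dist (a i) (a k))
      (dist_pos.2 (ha.injective.ne hik))
      (fun h ↦ by
        rw [h, Finset.card_univ, Fintype.card_fin] at hcard
        lia)
      (by
        simp only [Finset.mem_insert, Finset.mem_singleton, forall_eq_or_imp, forall_eq]
        exact ⟨s.height_le_dist hik, dist_comm (a i) (a k) ▸ s.height_le_dist hik.symm⟩)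
    simpa [hcard] using h
  · set M := ⨆ q : {q : Fin (m + 1) × Fin (m + 1) // q.1 ≠ q.2 ∧ q.1 ≠ j ∧ q.2 ≠ j},
      dist (a q.1.1) (a q.1.2)
    have hheight (i) (hi : i ≠ j) : s.height i ≤ M := by
      obtain ⟨k, hk⟩ : ∃ k, k ∉ ({i, j} : Finset (Fin (m + 1))) := by
        by_contra! h
        have := Finset.card_le_two (a := i) (b := j)
        rw [Finset.eq_univ_of_forall h, Finset.card_univ, Fintype.card_fin] at this
        lia
      simp only [Finset.mem_insert, Finset.mem_singleton, not_or] at hk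
      exact (s.height_le_dist (Ne.symm hk.1)).trans (le_ciSup (f := fun q :
        {q : Fin (m + 1) × Fin (m + 1) // q.1 ≠ q.2 ∧ q.1 ≠ j ∧ q.2 ≠ j} ↦
          dist (a q.1.1) (a q.1.2)) (Set.finite_range _).bddAbove
        ⟨(i, k), Ne.symm hk.1, hi, hk.2⟩)
    have : Nontrivial (Fin (m + 1)) := Fin.nontrivial_iff_two_le.2 (by lia)
    obtain ⟨i, hi⟩ := exists_ne j
    have h := s.card_mul_inradius_lt (I := Finset.univ.erase j)
      ((s.height_pos i).trans_le (hheight i hi))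
      (fun h ↦ Finset.notMem_erase j _ (h.symm ▸ Finset.mem_univ j))
      (fun i hi ↦ hheight i (Finset.ne_of_mem_erase hi))
    have hm : (2 : ℝ) ≤ m := mod_cast Nat.AtLeastTwo.prop
    rw [Finset.card_erase_of_mem (Finset.mem_univ j), Finset.card_univ, Fintype.card_fin,
      Nat.add_sub_cancel] at h
    rw [lt_div_iff₀ (by push_cast; linarith)]
    push_cast
    nlinarith [s.inradius_pos]
end

section
/- Let d ≥ 3, f ≥ 2, and n = (d+1)f. Let a : {1,…,n} → ℝ^d be a family of n points (repetitions allowed), and let G ⊆ {1,…,n} with |G| ≥ n − f (the indices of non-faulty inputs). Define δ* = inf over p ∈ ℝ^d of (max over subsets T ⊆ {1,…,n} with |T| = n − f of the Euclidean distance from p to convexHull{a_t : t ∈ T}). If all the points a_g with g ∈ G are equal, then δ* = 0. Otherwise, δ* < (max over g, h ∈ G of ‖a_g − a_h‖₂)/(d − 1). -/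
/-- The optimal relaxation parameter for `(δ,2)`-relaxed exact Byzantine vector consensus
with `m` inputs `x : Fin m → ℝ^d` and up to `f` faults:
`δ* = inf_p max_{T ⊆ [m], |T| = m - f} dist(p, convexHull {x_t : t ∈ T})`. -/
noncomputable def deltaStar (d f m : ℕ) (x : Fin m → EuclideanSpace ℝ (Fin d)) : ℝ :=
  ⨅ p : EuclideanSpace ℝ (Fin d),
    ⨆ T : {T : Finset (Fin m) // T.card = m - f},
      Metric.infDist p (convexHull ℝ (x '' ↑T.1))

/-- Adjoining a point within distance `D` of the others to a finite family of `k` points moves the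
centroid by at most `D / (k + 1)`. -/
lemma dist_centerMass_insert_le {ι E : Type*} [DecidableEq ι] [NormedAddCommGroup E]
    [NormedSpace ℝ E] {t : Finset ι} {j : ι} (hj : j ∉ t) (ht : t.Nonempty) (z : ι → E) {D : ℝ}
    (hD : ∀ i ∈ t, dist (z i) (z j) ≤ D) :
    dist ((insert j t).centerMass (fun _ => (1 : ℝ)) z) (t.centerMass (fun _ => (1 : ℝ)) z) ≤
      D / (t.card + 1) := by
  have hpos : (0 : ℝ) < t.card := by exact_mod_cast ht.card_pos
  have hsum : ∑ _i ∈ t, (1 : ℝ) = t.card := by simp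
  have hmem : t.centerMass (fun _ => (1 : ℝ)) z ∈ Metric.closedBall (z j) D :=
    (convex_closedBall (z j) D).centerMass_mem (fun _ _ => zero_le_one) (hsum ▸ hpos)
      fun i hi => Metric.mem_closedBall.2 (hD i hi)
  rw [Finset.centerMass_insert j t z hj (hsum ▸ hpos.ne'), hsum]
  set q := t.centerMass (fun _ => (1 : ℝ)) z
  have hdiff : (1 / (1 + (t.card : ℝ))) • z j + ((t.card : ℝ) / (1 + t.card)) • q - q =
      (1 / (1 + (t.card : ℝ))) • (z j - q) := by
    match_scalars
    · ring
    · field_simp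
      ring
  rw [dist_eq_norm, hdiff, norm_smul, ← dist_eq_norm, dist_comm,
    Real.norm_of_nonneg (by positivity), div_mul_eq_mul_div, one_mul, add_comm]
  gcongr
  exact hmem

/-- If the complements of at most `k` sets, each complement of size `f`, cover a type with `k * f`
elements, then these complements are the fibers of a map into the family. -/
lemma exists_map_fiber_eq_compl {α : Type*} [Fintype α] [DecidableEq α] {k f : ℕ}
    (hα : Fintype.card α = k * f) (I : Finset (Finset α)) (hI : I.card ≤ k)
    (hf : ∀ T ∈ I, Tᶜ.card = f) (hcover : ∀ x, ∃ T ∈ I, x ∉ T) :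
    ∃ c : α → Finset α, (∀ x, c x ∈ I) ∧ ∀ T ∈ I, ∀ x, x ∈ T ↔ c x ≠ T := by
  choose c hcI hc using hcover
  have hsub : ∀ T ∈ I, ({x | c x = T} : Finset α) ⊆ Tᶜ := by
    intro T _ x hx
    simp only [Finset.mem_filter, Finset.mem_univ, true_and] at hx
    exact Finset.mem_compl.2 (hx ▸ hc x)
  have hle : ∀ T ∈ I, ({x | c x = T} : Finset α).card ≤ Tᶜ.card :=
    fun T hT => Finset.card_le_card (hsub T hT)
  have hsum : ∑ T ∈ I, ({x | c x = T} : Finset α).card = ∑ T ∈ I, Tᶜ.card := by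
    refine le_antisymm (Finset.sum_le_sum hle) ?_
    rw [← Finset.card_eq_sum_card_fiberwise (s := Finset.univ) fun x _ => hcI x,
      Finset.sum_congr rfl hf, Finset.sum_const, smul_eq_mul, Finset.card_univ, hα]
    gcongr
  have heq := (Finset.sum_eq_sum_iff_of_le hle).1 hsum
  refine ⟨c, hcI, fun T hT x => ?_⟩
  have hfib := Finset.eq_of_subset_of_card_le (hsub T hT) (heq T hT).ge
  have hx : c x = T ↔ x ∉ T := by simpa using Finset.ext_iff.1 hfib x
  tauto

/-- Some point is within `D / d` of the convex hull of every subfamily of size `(d + 1) * f - f`,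
where `D` bounds the distances between points indexed by `G`. -/
lemma exists_forall_infDist_convexHull_le {d f : ℕ} (hd : 2 ≤ d) (hf : 0 < f)
    (a : Fin ((d + 1) * f) → EuclideanSpace ℝ (Fin d))
    (G : Finset (Fin ((d + 1) * f))) (hG : (d + 1) * f - f ≤ G.card) {D : ℝ} (hD0 : 0 ≤ D)
    (hD : ∀ g ∈ G, ∀ h ∈ G, dist (a g) (a h) ≤ D) :
    ∃ p, ∀ T : Finset (Fin ((d + 1) * f)), T.card = (d + 1) * f - f →
      Metric.infDist p (convexHull ℝ (a '' ↑T)) ≤ D / d := by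
  classical
  have hn : (d + 1) * f - f = d * f := by rw [add_mul, one_mul, Nat.add_sub_cancel]
  rw [hn] at hG ⊢
  have hδ : 0 ≤ D / d := by positivity
  have hdpos : (0 : ℝ) < d := by positivity
  let 𝒯 : Finset (Finset (Fin ((d + 1) * f))) := {T | T.card = d * f}
  obtain ⟨p, hp⟩ : (⋂ T ∈ 𝒯, Metric.cthickening (D / d)
      (convexHull ℝ (a '' (↑T : Set (Fin ((d + 1) * f)))))).Nonempty := by
    refine Convex.helly_theorem' (𝕜 := ℝ) (fun T _ => (convex_convexHull ℝ _).cthickening _) ?_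
    intro I hI hIcard
    rw [finrank_euclideanSpace_fin] at hIcard
    by_cases hcover : ∃ x, ∀ T ∈ I, x ∈ T
    · obtain ⟨x, hx⟩ := hcover
      exact ⟨a x, Set.mem_iInter₂.2 fun T hT => Metric.self_subset_cthickening _
        (subset_convexHull ℝ _ ⟨x, hx T hT, rfl⟩)⟩
    push Not at hcover
    have hcompl : ∀ T ∈ I, Tᶜ.card = f := fun T hT => by
      have hTcard : T.card = d * f := (Finset.mem_filter.1 (hI hT)).2
      rw [Finset.card_compl, hTcard, Fintype.card_fin, add_mul, one_mul, Nat.add_sub_cancel_left]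
    obtain ⟨c, hcI, hc⟩ :=
      exists_map_fiber_eq_compl (Fintype.card_fin _) I hIcard hcompl hcover
    have hfiber : ∀ T ∈ G.image c, ({x ∈ G | c x = T}).card ≤ f := by
      intro T hT
      obtain ⟨y, -, rfl⟩ := Finset.mem_image.1 hT
      refine (Finset.card_le_card fun x hx => ?_).trans (hcompl _ (hcI y)).le
      exact Finset.mem_compl.2 fun hxT => (hc _ (hcI y) x).1 hxT (Finset.mem_filter.1 hx).2
    have himage : d ≤ (G.image c).card :=
      Nat.le_of_mul_le_mul_left
        (by simpa [mul_comm] using hG.trans (Finset.card_le_mul_card_image G f hfiber)) hf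
    obtain ⟨J, hJ, hJcard⟩ := Finset.exists_subset_card_eq himage
    have hrep : ∀ T, ∃ x, T ∈ J → x ∈ G ∧ c x = T := fun T => by
      by_cases hT : T ∈ J
      · obtain ⟨x, hx⟩ := Finset.mem_image.1 (hJ hT)
        exact ⟨x, fun _ => hx⟩
      · exact ⟨⟨0, by positivity⟩, fun h => absurd h hT⟩
    choose s hs using hrep
    have hcenter : ∀ T ∈ I, ∀ t ⊆ J, t.Nonempty → T ∉ t →
        t.centerMass (fun _ => (1 : ℝ)) (a ∘ s) ∈ convexHull ℝ (a '' (T : Set _)) := by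
      intro T hT t ht htne hTt
      refine t.centerMass_mem_convexHull (fun _ _ => zero_le_one) (by simpa using htne) ?_
      intro U hU
      refine ⟨s U, (hc T hT _).2 ?_, rfl⟩
      rw [(hs U (ht hU)).2]
      rintro rfl
      exact hTt hU
    refine ⟨J.centerMass (fun _ => (1 : ℝ)) (a ∘ s), Set.mem_iInter₂.2 fun T hT => ?_⟩
    by_cases hTJ : T ∈ J
    · have hcard : (J.erase T).card + 1 = d := by rw [Finset.card_erase_add_one hTJ, hJcard]
      have hne : (J.erase T).Nonempty := Finset.card_pos.1 (by omega)
      refine Metric.mem_cthickening_of_dist_le _ _ _ _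
        (hcenter T hT _ (Finset.erase_subset T J) hne (Finset.notMem_erase T J)) ?_
      have hdist := dist_centerMass_insert_le (Finset.notMem_erase T J) hne (a ∘ s) (D := D)
        fun U hU => hD _ (hs U (Finset.mem_of_mem_erase hU)).1 _ (hs T hTJ).1
      rwa [Finset.insert_erase hTJ, ← Nat.cast_add_one, hcard] at hdist
    · exact Metric.self_subset_cthickening _
        (hcenter T hT J subset_rfl (Finset.card_pos.1 (by omega)) hTJ)
  refine ⟨p, fun T hT => ?_⟩
  have hpT := Set.mem_iInter₂.1 hp T (by simp [𝒯, hT])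
  exact ENNReal.toReal_le_of_le_ofReal hδ (Metric.mem_cthickening_iff.1 hpT)

lemma deltaStar_nonneg (d f m : ℕ) (x : Fin m → EuclideanSpace ℝ (Fin d)) :
    0 ≤ deltaStar d f m x :=
  Real.iInf_nonneg fun _ => Real.iSup_nonneg fun _ => Metric.infDist_nonneg

lemma deltaStar_le {d f m : ℕ} {x : Fin m → EuclideanSpace ℝ (Fin d)} {δ : ℝ} (hδ : 0 ≤ δ)
    (p : EuclideanSpace ℝ (Fin d)) (hp : ∀ T : Finset (Fin m), T.card = m - f →
      Metric.infDist p (convexHull ℝ (x '' ↑T)) ≤ δ) :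
    deltaStar d f m x ≤ δ := by
  refine (ciInf_le ⟨0, ?_⟩ p).trans (Real.iSup_le (fun T => hp T.1 T.2) hδ)
  rintro _ ⟨q, rfl⟩
  exact Real.iSup_nonneg fun _ => Metric.infDist_nonneg

/-- For `d ≥ 3`, `f ≥ 2`, `n = (d+1)f` inputs `a : Fin n → ℝ^d`, and a set `G` of at
least `n - f` non-faulty indices: if all non-faulty inputs are equal then `δ* = 0`,
and otherwise `δ* < (max_{g,h ∈ G} ‖a_g - a_h‖₂)/(d - 1)`. -/
theorem deltaStar_bound_f_ge_two (d f : ℕ) (hd : 3 ≤ d) (hf : 2 ≤ f)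
    (a : Fin ((d + 1) * f) → EuclideanSpace ℝ (Fin d))
    (G : Finset (Fin ((d + 1) * f))) (hG : (d + 1) * f - f ≤ G.card) :
    ((∀ g ∈ G, ∀ h ∈ G, a g = a h) → deltaStar d f ((d + 1) * f) a = 0) ∧
    ((¬ ∀ g ∈ G, ∀ h ∈ G, a g = a h) →
      deltaStar d f ((d + 1) * f) a <
        (⨆ g : G, ⨆ h : G, dist (a g) (a h)) / ((d : ℝ) - 1)) := by
  have hbound {D : ℝ} (hD0 : 0 ≤ D) (hD : ∀ g ∈ G, ∀ h ∈ G, dist (a g) (a h) ≤ D) :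
      deltaStar d f ((d + 1) * f) a ≤ D / d := by
    obtain ⟨p, hp⟩ :=
      exists_forall_infDist_convexHull_le (by omega) (by omega) a G hG hD0 hD
    exact deltaStar_le (by positivity) p hp
  constructor
  · intro heq
    refine le_antisymm ?_ (deltaStar_nonneg d f _ a)
    simpa using hbound le_rfl fun g hg h hh => (dist_eq_zero.2 (heq g hg h hh)).le
  · intro hne
    push Not at hne
    obtain ⟨g, hg, h, hh, hgh⟩ := hne
    set D := ⨆ g : G, ⨆ h : G, dist (a g) (a h) with hDdef
    have hD : ∀ g ∈ G, ∀ h ∈ G, dist (a g) (a h) ≤ D := fun g hg h hh =>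
      (le_ciSup (f := fun h : G => dist (a g) (a h)) (Set.finite_range _).bddAbove ⟨h, hh⟩).trans
        (le_ciSup (f := fun g : G => ⨆ h : G, dist (a g) (a h)) (Set.finite_range _).bddAbove
          ⟨g, hg⟩)
    have hDpos : 0 < D := (dist_pos.2 hgh).trans_le (hD g hg h hh)
    have hd' : (3 : ℝ) ≤ d := by exact_mod_cast hd
    exact (hbound hDpos.le hD).trans_lt
      (div_lt_div_of_pos_left hDpos (by linarith) (by linarith))
end

section
/- Let d ≥ 3, f ≥ 2, and let n be an integer with 3f+1 < n ≤ (d+1)f. Let a_1,…,a_n ∈ ℝ^d (repetitions allowed), and let a_1,…,a_{n−1} be the family obtained by removing one point (say the last). Define, for a family x_1,…,x_m with m > f, δ*(x) = inf over p ∈ ℝ^d of (max over subsets T ⊆ {1,…,m} with |T| = m − f of the Euclidean distance from p to convexHull{x_t : t ∈ T}). Then δ*(a_1,…,a_n) ≤ δ*(a_1,…,a_{n−1}). -/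
/-- A set of `n - f` indices contains, after discarding the last index or an arbitrary one,
a set of `n - 1 - f` indices among the first `n - 1`. -/
theorem exists_card_sub_one_forall_castLE_mem {n f : ℕ} (hn : 0 < n)
    (T : Finset (Fin n)) (hT : T.card = n - f) :
    ∃ U : Finset (Fin (n - 1)), U.card = n - 1 - f ∧
      ∀ i ∈ U, Fin.castLE (Nat.sub_le n 1) i ∈ T := by
  classical
  set V : Finset (Fin (n - 1)) :=
    Finset.univ.filter fun i => Fin.castLE (Nat.sub_le n 1) i ∈ T with hV
  have hsub : T.erase ⟨n - 1, by omega⟩ ⊆ V.image (Fin.castLE (Nat.sub_le n 1)) := by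
    intro j hj
    obtain ⟨hne, hjT⟩ := Finset.mem_erase.mp hj
    have hlt : (j : ℕ) < n - 1 := by
      have hval : (j : ℕ) ≠ n - 1 := fun h => hne (Fin.ext h)
      omega
    exact Finset.mem_image.mpr ⟨⟨j, hlt⟩, by simpa [hV] using hjT, rfl⟩
  have hcard : n - 1 - f ≤ V.card := by
    have h₁ := Finset.card_le_card hsub
    have h₂ := Finset.card_image_le (s := V) (f := Fin.castLE (Nat.sub_le n 1))
    have h₃ := Finset.pred_card_le_card_erase (s := T) (a := ⟨n - 1, by omega⟩)
    omega
  obtain ⟨U, hUV, hU⟩ := Finset.exists_subset_card_eq hcard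
  exact ⟨U, hU, fun i hi => (Finset.mem_filter.mp (hUV hi)).2⟩

/-- For `d ≥ 3`, `f ≥ 2` and `3f + 1 < n ≤ (d+1)f`, removing one input from the family
`a_1, …, a_n` does not decrease the optimal relaxation parameter:
`δ*(a_1, …, a_n) ≤ δ*(a_1, …, a_{n-1})`. -/
theorem deltaStar_le_of_remove (d f n : ℕ) (hd : 3 ≤ d) (hf : 2 ≤ f)
    (hn1 : 3 * f + 1 < n) (hn2 : n ≤ (d + 1) * f)
    (a : Fin n → EuclideanSpace ℝ (Fin d)) :
    deltaStar d f n a ≤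
      deltaStar d f (n - 1) (fun i => a (Fin.castLE (Nat.sub_le n 1) i)) := by
  unfold deltaStar
  refine ciInf_mono ⟨0, ?_⟩ fun p => ?_
  · rintro _ ⟨p, rfl⟩
    exact Real.iSup_nonneg fun T => Metric.infDist_nonneg
  · have : Nonempty {T : Finset (Fin n) // T.card = n - f} := by
      obtain ⟨T, -, hT⟩ := Finset.exists_subset_card_eq
        (s := (Finset.univ : Finset (Fin n))) (n := n - f) (by simp)
      exact ⟨⟨T, hT⟩⟩
    refine ciSup_le fun T => ?_
    obtain ⟨U, hU, hUT⟩ := exists_card_sub_one_forall_castLE_mem (by omega) T.1 T.2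
    have hne : U.Nonempty := Finset.card_pos.mp (by omega)
    refine le_trans ?_ (le_ciSup (Set.finite_range _).bddAbove
      (⟨U, hU⟩ : {T : Finset (Fin (n - 1)) // T.card = n - 1 - f}))
    refine Metric.infDist_le_infDist_of_subset (convexHull_mono ?_) ?_
    · rintro _ ⟨i, hi, rfl⟩
      exact ⟨_, hUT i hi, rfl⟩
    · exact (hne.to_set.image _).convexHull
end

section
/- Let d ≥ 1 and let S be a finite family of points in ℝ^d (repetitions allowed) partitioned into d+1 nonempty pairwise disjoint sub-families F_1,…,F_{d+1}. For each k ∈ {1,…,d+1}, let Q_k be the union of all F_i with i ≠ k. Assume that the intersection ⋂_{k=1}^{d+1} convexHull(Q_k) is empty. Then for every choice of points z_k ∈ F_k for k = 1,…,d+1, the d+1 points z_1,…,z_{d+1} are affinely independent (so their convex hull is a d-dimensional simplex). -/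
/-- Claim: if a finite family `a : Fin m → ℝ^d` of points (repetitions allowed) is
partitioned into `d+1` nonempty pairwise disjoint sub-families `F_k = φ⁻¹{k}` (given by
a surjective index map `φ`), `Q_k` is the union of all `F_i` with `i ≠ k`, and the
intersection `⋂ k, convexHull (Q_k)` is empty, then any choice of one point `z_k` from
each `F_k` yields `d+1` affinely independent points. -/
theorem choice_points_affineIndependent (d m : ℕ) (hd : 1 ≤ d)
    (a : Fin m → EuclideanSpace ℝ (Fin d)) (φ : Fin m → Fin (d + 1))
    (hφ : Function.Surjective φ)
    (hempty : (⋂ k : Fin (d + 1), convexHull ℝ (a '' {j | φ j ≠ k})) = ∅)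
    (z : Fin (d + 1) → Fin m) (hz : ∀ k, φ (z k) = k) :
    AffineIndependent ℝ (a ∘ z) := by
  by_contra h
  obtain ⟨I, p, hI, hIc⟩ := Convex.radon_partition h
  have hp : p ∈ ⋂ k : Fin (d + 1), convexHull ℝ (a '' {j | φ j ≠ k}) := by
    refine Set.mem_iInter.2 fun k ↦ ?_
    have hsub (J : Set (Fin (d + 1))) (hk : k ∉ J) : (a ∘ z) '' J ⊆ a '' {j | φ j ≠ k} := by
      rintro _ ⟨i, hi, rfl⟩
      refine ⟨z i, ?_, rfl⟩
      rintro rfl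
      exact hk (by rwa [hz i])
    by_cases hk : k ∈ I
    · exact convexHull_mono (hsub Iᶜ fun hkc ↦ hkc hk) hIc
    · exact convexHull_mono (hsub I hk) hI
  rw [hempty] at hp
  exact hp
end

section
/- Let d ≥ 1 and let S be a finite family of points in ℝ^d (repetitions allowed) partitioned into d+1 nonempty pairwise disjoint sub-families F_1,…,F_{d+1}. For each k ∈ {1,…,d+1}, let Q_k be the union of all F_i with i ≠ k. Assume that the intersection ⋂_{k=1}^{d+1} convexHull(Q_k) is empty. Then for every choice of points w_k ∈ F_k for k = 1,…,d+1, the set difference convexHull(S) \ (⋃_{k=1}^{d+1} convexHull(Q_k)) is contained in convexHull({w_1,…,w_{d+1}}). -/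
/-- In a convex combination of points indexed by `ι`, if every point with nonzero weight carries an
index in `T`, then the combination lies in the convex hull of the points indexed by `T`. -/
theorem sum_smul_mem_convexHull_image {ι κ E : Type*} [Fintype κ] [AddCommGroup E] [Module ℝ E]
    {a : ι → E} {T : Set ι} {u : κ → ι} {c : κ → ℝ} (h0 : ∀ i, 0 ≤ c i) (h1 : ∑ i, c i = 1)
    (hT : ∀ i, c i ≠ 0 → u i ∈ T) : ∑ i, c i • a (u i) ∈ convexHull ℝ (a '' T) := by
  have h := (convex_convexHull ℝ (a '' T)).finsum_mem (w := c) (z := fun i => a (u i)) h0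
    (by rw [finsum_eq_sum_of_fintype, h1])
    (fun i hi => subset_convexHull ℝ _ ⟨u i, hT i hi, rfl⟩)
  rwa [finsum_eq_sum_of_fintype] at h

/-- A sum over `Option κ` whose term at `some i` vanishes is a sum over `κ` in which the term
at `none` takes the place of the one at `i`. -/
theorem sum_ite_none_some {κ A : Type*} [Fintype κ] [DecidableEq κ] [AddCommMonoid A]
    (f : Option κ → A) (i : κ) (hi : f (some i) = 0) :
    ∑ k, f (if k = i then none else some k) = ∑ o, f o := by
  rw [Fintype.sum_option, ← Finset.add_sum_erase _ _ (Finset.mem_univ i),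
    ← Finset.add_sum_erase _ (fun k => f (some k)) (Finset.mem_univ i), hi, zero_add, if_pos rfl]
  congr 1
  refine Finset.sum_congr rfl fun k hk => ?_
  rw [if_neg (Finset.ne_of_mem_erase hk)]

/-- A nonnegative vector can be moved along a direction with a negative entry until, while
still nonnegative, one of its entries with negative direction vanishes. -/
theorem exists_nonneg_add_mul_eq_zero {κ : Type*} [Finite κ] {c μ : κ → ℝ} (hc : ∀ k, 0 ≤ c k)
    (hμ : ∃ k, μ k < 0) :
    ∃ s : ℝ, 0 ≤ s ∧ (∀ k, 0 ≤ c k + s * μ k) ∧ ∃ k, c k + s * μ k = 0 := by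
  obtain ⟨k, hk, hmin⟩ := Set.exists_min_image {k | μ k < 0} (fun k => c k / -μ k)
    (Set.toFinite _) hμ
  simp only [Set.mem_ofPred_eq] at hk hmin
  have hs : 0 ≤ c k / -μ k := div_nonneg (hc k) (by linarith)
  refine ⟨c k / -μ k, hs, fun l => ?_, k, ?_⟩
  · rcases lt_or_ge (μ l) 0 with hl | hl
    · have h := hmin l hl
      rw [le_div_iff₀ (by linarith)] at h
      linarith
    · exact add_nonneg (hc l) (mul_nonneg hs hl)
  · have : μ k ≠ 0 := hk.ne
    field_simp
    ring

/-- A family of more than `finrank + 1` points, indexed by `Option κ`, has a nontrivial affine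
dependency with nonnegative weight at `none` and a negative weight elsewhere. -/
theorem exists_affine_dependency_option {κ E : Type*} [Fintype κ] [AddCommGroup E] [Module ℝ E]
    [FiniteDimensional ℝ E] (hcard : Module.finrank ℝ E < Fintype.card κ) (p : Option κ → E) :
    ∃ μ : Option κ → ℝ, ∑ o, μ o = 0 ∧ ∑ o, μ o • p o = 0 ∧ 0 ≤ μ none ∧
      ∃ k, μ (some k) < 0 := by
  have hp : ¬ AffineIndependent ℝ p := fun h => by
    have h1 := h.card_le_finrank_succ
    have h2 := Submodule.finrank_le (vectorSpan ℝ (Set.range p))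
    rw [Fintype.card_option] at h1
    omega
  obtain ⟨μ, hμ, hμp, hne, h0⟩ : ∃ μ : Option κ → ℝ, ∑ o, μ o = 0 ∧ ∑ o, μ o • p o = 0 ∧
      (∃ o, μ o ≠ 0) ∧ 0 ≤ μ none := by
    rw [affineIndependent_iff] at hp
    push Not at hp
    obtain ⟨t, μ, hμ, hμp, o, ho, hne⟩ := hp
    classical
    have e1 : ∑ o, (if o ∈ t then μ o else 0) = 0 := by simpa using hμ
    have e2 : ∑ o, (if o ∈ t then μ o else 0) • p o = 0 := by simpa [ite_smul] using hμp
    rcases le_total 0 (if none ∈ t then μ none else 0) with h | h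
    · exact ⟨fun o => if o ∈ t then μ o else 0, e1, e2, ⟨o, by simpa [ho] using hne⟩, h⟩
    · exact ⟨fun o => -(if o ∈ t then μ o else 0), by rw [Finset.sum_neg_distrib, e1, neg_zero],
        by simp only [neg_smul]; rw [Finset.sum_neg_distrib, e2, neg_zero],
        ⟨o, by simpa [ho] using hne⟩, neg_nonneg.2 h⟩
  refine ⟨μ, hμ, hμp, h0, ?_⟩
  by_contra! hk
  obtain ⟨o, ho⟩ := hne
  have hall : ∀ o ∈ Finset.univ, 0 ≤ μ o := by
    rintro (_ | k) -
    exacts [h0, hk k]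
  exact ho ((Finset.sum_eq_zero_iff_of_nonneg hall).1 hμ o (Finset.mem_univ o))

/-- If `x` avoids the convex hull of every family missing a color, then a point of a rainbow simplex
containing `x` can be exchanged for any other point of the same color. -/
theorem exists_weights_update {ι κ E : Type*} [Fintype κ] [DecidableEq κ] [AddCommGroup E]
    [Module ℝ E] [FiniteDimensional ℝ E] (hcard : Module.finrank ℝ E < Fintype.card κ)
    {a : ι → E} {φ : ι → κ} {x : E} (hx : ∀ k, x ∉ convexHull ℝ (a '' {j | φ j ≠ k}))
    {v : κ → ι} (hv : ∀ k, φ (v k) = k) (j : ι)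
    (h : ∃ c : κ → ℝ, (∀ k, 0 ≤ c k) ∧ ∑ k, c k = 1 ∧ ∑ k, c k • a (v k) = x) :
    ∃ c : κ → ℝ, (∀ k, 0 ≤ c k) ∧ ∑ k, c k = 1 ∧
      ∑ k, c k • a (Function.update v (φ j) j k) = x := by
  obtain ⟨c, hc, hc1, hcx⟩ := h
  let u : Option κ → ι := fun o => o.elim j v
  obtain ⟨μ, hμ, hμp, h0, hneg⟩ := exists_affine_dependency_option hcard (fun o => a (u o))
  obtain ⟨s, hs, hnn, k, hk⟩ := exists_nonneg_add_mul_eq_zero (μ := fun k => μ (some k)) hc hneg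
  let M : Option κ → ℝ := fun o => o.elim 0 c + s * μ o
  have hM : ∀ o, 0 ≤ M o := by
    rintro (_ | k)
    · simpa [M] using mul_nonneg hs h0
    · exact hnn k
  have hM1 : ∑ o, M o = 1 := by
    simp only [M, Finset.sum_add_distrib, ← Finset.mul_sum, hμ]
    simpa using hc1
  have hMx : ∑ o, M o • a (u o) = x := by
    simp only [M, add_smul, mul_smul, Finset.sum_add_distrib, ← Finset.smul_sum, hμp]
    simpa [u] using hcx
  have hMk : M (some k) = 0 := hk
  obtain rfl : k = φ j := by
    by_contra hne
    refine hx k (hMx ▸ sum_smul_mem_convexHull_image hM hM1 ?_)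
    rintro (_ | l) hl
    · exact Ne.symm hne
    · change φ (v l) ≠ k
      rw [hv]
      rintro rfl
      exact hl hMk
  refine ⟨fun k => M (if k = φ j then none else some k), fun k => hM _, ?_, ?_⟩
  · rw [sum_ite_none_some M _ hMk, hM1]
  · rw [← hMx, ← sum_ite_none_some (fun o => M o • a (u o)) (φ j) (by simp [hMk])]
    refine Finset.sum_congr rfl fun k _ => ?_
    by_cases h : k = φ j
    · subst h
      simp [u]
    · simp [h, u]

/-- If `x` lies in the convex hull of a colored family with more colors than the dimension, but in
no convex hull of a family missing a color, then some rainbow simplex contains `x`. -/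
theorem exists_rainbow_weights {ι κ E : Type*} [Fintype κ] [AddCommGroup E]
    [Module ℝ E] [FiniteDimensional ℝ E] (hcard : Module.finrank ℝ E < Fintype.card κ)
    {a : ι → E} {φ : ι → κ} {x : E} (hx : ∀ k, x ∉ convexHull ℝ (a '' {j | φ j ≠ k}))
    (hmem : x ∈ convexHull ℝ (Set.range a)) :
    ∃ v : κ → ι, (∀ k, φ (v k) = k) ∧
      ∃ c : κ → ℝ, (∀ k, 0 ≤ c k) ∧ ∑ k, c k = 1 ∧ ∑ k, c k • a (v k) = x := by
  obtain ⟨α, _, z, c, hz, hind, hc, hc1, hcx⟩ := eq_pos_convex_span_of_mem_convexHull hmem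
  choose g hg using fun i => hz (Set.mem_range_self i)
  have hsurj : Function.Surjective fun i => φ (g i) := by
    intro k
    by_contra! hk
    refine hx k ?_
    have := sum_smul_mem_convexHull_image (a := a) (T := {j | φ j ≠ k}) (u := g)
      (fun i => (hc i).le) hc1 (fun i _ => hk i)
    simpa only [hg, hcx] using this
  have hle : Fintype.card α ≤ Fintype.card κ := by
    have h1 := hind.card_le_finrank_succ
    have h2 := Submodule.finrank_le (vectorSpan ℝ (Set.range z))
    omega
  have hbij : Function.Bijective fun i => φ (g i) :=
    (Fintype.bijective_iff_surjective_and_card _).2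
      ⟨hsurj, hle.antisymm (Fintype.card_le_of_surjective _ hsurj)⟩
  let e := Equiv.ofBijective _ hbij
  refine ⟨fun k => g (e.symm k), e.apply_symm_apply, fun k => c (e.symm k),
    fun k => (hc _).le, ?_, ?_⟩
  · rw [Equiv.sum_comp e.symm c, hc1]
  · simp only [hg]
    rw [Equiv.sum_comp e.symm (fun i => c i • z i), hcx]

/-- Claim: if a finite family `a : Fin m → ℝ^d` of points (repetitions allowed) is
partitioned into `d+1` nonempty pairwise disjoint sub-families `F_k = φ⁻¹{k}` (given by
a surjective index map `φ`), `Q_k` is the union of all `F_i` with `i ≠ k`, and the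
intersection `⋂ k, convexHull (Q_k)` is empty, then for any choice of one point `w_k`
from each `F_k`, the set `convexHull(S) \ ⋃ k, convexHull(Q_k)` is contained in
`convexHull {w_1, …, w_{d+1}}`. -/
theorem hull_diff_subset_hull_choice (d m : ℕ) (hd : 1 ≤ d)
    (a : Fin m → EuclideanSpace ℝ (Fin d)) (φ : Fin m → Fin (d + 1))
    (hφ : Function.Surjective φ)
    (hempty : (⋂ k : Fin (d + 1), convexHull ℝ (a '' {j | φ j ≠ k})) = ∅)
    (w : Fin (d + 1) → Fin m) (hw : ∀ k, φ (w k) = k) :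
    convexHull ℝ (Set.range a) \ (⋃ k : Fin (d + 1), convexHull ℝ (a '' {j | φ j ≠ k}))
      ⊆ convexHull ℝ (Set.range (a ∘ w)) := by
  rintro x ⟨hmem, hx⟩
  have hx : ∀ k, x ∉ convexHull ℝ (a '' {j | φ j ≠ k}) := by simpa using hx
  have hcard : Module.finrank ℝ (EuclideanSpace ℝ (Fin d)) < Fintype.card (Fin (d + 1)) := by
    simp
  have key : ∀ T : Finset (Fin (d + 1)), ∃ v : Fin (d + 1) → Fin m, (∀ k, φ (v k) = k) ∧
      (∀ k ∈ T, v k = w k) ∧ ∃ c : Fin (d + 1) → ℝ, (∀ k, 0 ≤ c k) ∧ ∑ k, c k = 1 ∧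
        ∑ k, c k • a (v k) = x := by
    intro T
    induction T using Finset.induction_on with
    | empty =>
      obtain ⟨v, hv, h⟩ := exists_rainbow_weights hcard hx hmem
      exact ⟨v, hv, by simp, h⟩
    | insert i T _ ih =>
      obtain ⟨v, hv, hT, h⟩ := ih
      have h' := exists_weights_update hcard hx hv (w i) h
      rw [hw] at h'
      refine ⟨Function.update v i (w i), fun k => ?_, fun k hk => ?_, h'⟩
      · by_cases h : k = i
        · subst h
          simp [hw]
        · simp [h, hv]
      · by_cases h : k = i
        · subst h
          simp
        · simpa [h] using hT k (Finset.mem_of_mem_insert_of_ne hk h)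
  obtain ⟨v, -, hT, c, hc, hc1, hcx⟩ := key Finset.univ
  obtain rfl : v = w := funext fun k => hT k (Finset.mem_univ k)
  exact mem_convexHull_of_exists_fintype c (a ∘ v) hc hc1 (fun k => Set.mem_range_self k) hcx
end
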